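/- Duhamel integral in null coordinates (Proposition 2.20). Let F: ℝ² → ℝ be C_b^∞ and set φ := Duh[F], where Duh[H](u,v) := −∫_u^v (∫_u^{v'} H(u',v') du') dv'. Then: (1) φ(u,v) = −∫_u^v (∫_{u'}^{v} F(u',v') dv') du' for all (u,v) ∈ ℝ²; (2) φ is smooth and ∂_u∂_v φ = F everywhere on ℝ²; (3) φ(x,x) = 0 and (∂_v φ − ∂_u φ)(x,x) = 0 for every x ∈ ℝ; (4) for all γ₁, γ₂ ∈ (0,1) with γ₁ + γ₂ > 1 there is a constant C = C(γ₁, γ₂, χ) such that ‖(u,v) ↦ χ(u)χ(v)φ(u,v)‖_{C_u^{γ₁}C_v^{γ₂}} ≤ C‖F‖_{C_u^{γ₁−1}C_v^{γ₂−1}}. -/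

import Mathlib

noncomputable section

open Real MeasureTheory
open scoped ENNReal Classical NNReal

/-- A function between real normed spaces is `C_b^∞`: it is smooth and it together with all of
its iterated derivatives is bounded. -/
def CbSmooth {E F : Type*} [NormedAddCommGroup E] [NormedSpace ℝ E]
    [NormedAddCommGroup F] [NormedSpace ℝ F] (f : E → F) : Prop :=
  ContDiff ℝ (⊤ : ℕ∞) f ∧ ∀ n : ℕ, ∃ C : ℝ, ∀ x : E, ‖iteratedFDeriv ℝ n f x‖ ≤ C

/-- An admissible Littlewood–Paley cutoff: a smooth even `[0,1]`-valued function which is `≡ 1`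
on `{|ξ| ≤ 7/8}` and vanishes on `{|ξ| ≥ 9/8}`. -/
structure IsLPCutoff (ρ : ℝ → ℝ) : Prop where
  smooth : ContDiff ℝ (⊤ : ℕ∞) ρ
  nonneg : ∀ ξ, 0 ≤ ρ ξ
  le_one : ∀ ξ, ρ ξ ≤ 1
  even : ∀ ξ, ρ (-ξ) = ρ ξ
  eq_one : ∀ ξ : ℝ, |ξ| ≤ 7 / 8 → ρ ξ = 1
  eq_zero : ∀ ξ : ℝ, 9 / 8 ≤ |ξ| → ρ ξ = 0

/-- The Littlewood–Paley symbol `ρ_N` at the dyadic scale `N = 2 ^ k`. -/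
def lpSymbol (ρ : ℝ → ℝ) : ℕ → ℝ → ℝ
  | 0 => ρ
  | k + 1 => fun ξ => ρ (ξ / 2 ^ (k + 1)) - ρ (2 * ξ / 2 ^ (k + 1))

/-- The inverse Fourier transform `(2π)^{-1/2} ∫ e^{ixξ} g(ξ) dξ` of a real even function,
written as a cosine transform. -/
def invFourier (g : ℝ → ℝ) (x : ℝ) : ℝ :=
  (Real.sqrt (2 * Real.pi))⁻¹ * ∫ ξ : ℝ, Real.cos (x * ξ) * g ξ

/-- The Littlewood–Paley convolution kernel `ρ̌_N`, `N = 2 ^ k`. -/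
def lpKernel (ρ : ℝ → ℝ) (k : ℕ) : ℝ → ℝ :=
  invFourier (lpSymbol ρ k)

/-- The Littlewood–Paley projection `P_N f = ρ̌_N ∗ f`, `N = 2 ^ k`. -/
def LP (ρ : ℝ → ℝ) (k : ℕ) (f : ℝ → ℝ) (x : ℝ) : ℝ :=
  ∫ y : ℝ, lpKernel ρ k y * f (x - y)

/-- The Littlewood–Paley projection in the first variable. -/
def LPu (ρ : ℝ → ℝ) (k : ℕ) (F : ℝ × ℝ → ℝ) (p : ℝ × ℝ) : ℝ :=
  ∫ y : ℝ, lpKernel ρ k y * F (p.1 - y, p.2)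

/-- The Littlewood–Paley projection in the second variable. -/
def LPv (ρ : ℝ → ℝ) (k : ℕ) (F : ℝ × ℝ → ℝ) (p : ℝ × ℝ) : ℝ :=
  ∫ y : ℝ, lpKernel ρ k y * F (p.1, p.2 - y)

/-- The Hölder norm `‖f‖_{C^γ} = sup_N N^γ ‖P_N f‖_{L^∞}`, valued in `[0,∞]`. -/
def hNorm (ρ : ℝ → ℝ) (γ : ℝ) (f : ℝ → ℝ) : ℝ≥0∞ :=
  ⨆ k : ℕ, ENNReal.ofReal (((2 : ℝ) ^ k) ^ γ) * ⨆ x : ℝ, ENNReal.ofReal |LP ρ k f x|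

/-- The product Hölder norm `‖F‖_{C_u^{γ₁} C_v^{γ₂}}`, valued in `[0,∞]`. -/
def hNorm2 (ρ : ℝ → ℝ) (γ₁ γ₂ : ℝ) (F : ℝ × ℝ → ℝ) : ℝ≥0∞ :=
  ⨆ k₁ : ℕ, ⨆ k₂ : ℕ,
    ENNReal.ofReal (((2 : ℝ) ^ k₁) ^ γ₁ * ((2 : ℝ) ^ k₂) ^ γ₂) *
      ⨆ p : ℝ × ℝ, ENNReal.ofReal |LPu ρ k₁ (LPv ρ k₂ F) p|

/-- `2 ^ k₁ ∼ 2 ^ k₂`: comparable dyadic scales. -/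
def DClose (k₁ k₂ : ℕ) : Prop :=
  (2 : ℝ) ^ k₂ / 2 ^ 10 < (2 : ℝ) ^ k₁ ∧ (2 : ℝ) ^ k₁ < 2 ^ 10 * (2 : ℝ) ^ k₂

/-- `2 ^ k₁ ≪ 2 ^ k₂`. -/
def DLow (k₁ k₂ : ℕ) : Prop := (2 : ℝ) ^ k₁ ≤ (2 : ℝ) ^ k₂ / 2 ^ 10

/-- `2 ^ k₁ ≳ 2 ^ k₂`. -/
def DGtr (k₁ k₂ : ℕ) : Prop := (2 : ℝ) ^ k₂ ≤ 2 ^ 10 * (2 : ℝ) ^ k₁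

/-- An admissible spatial cutoff: a smooth `[0,1]`-valued function which is `≡ 1` on `[-2,2]`
and vanishes outside `[-21/10, 21/10]`. -/
structure IsCutoff (χ : ℝ → ℝ) : Prop where
  smooth : ContDiff ℝ (⊤ : ℕ∞) χ
  nonneg : ∀ x, 0 ≤ χ x
  le_one : ∀ x, χ x ≤ 1
  eq_one : ∀ x : ℝ, |x| ≤ 2 → χ x = 1
  eq_zero : ∀ x : ℝ, 21 / 10 < |x| → χ x = 0

/-- The Duhamel integral `Duh[H](u,v) = −∫_u^v ∫_u^{v'} H(u',v') du' dv'`. -/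
def Duh (H : ℝ × ℝ → ℝ) (p : ℝ × ℝ) : ℝ :=
  -∫ v' in p.1..p.2, ∫ u' in p.1..v', H (u', v')



/-- Sewing (bisection) lemma. -/
lemma sewing_bisect {f : ℝ → ℝ → ℝ} {K M θ : ℝ} (hθ : 1 < θ) (hK : 0 ≤ K) {L : ℝ}
    (hM : ∀ a b, |b - a| ≤ L → |f a b| ≤ M * |b - a| ^ 2)
    (hf : ∀ a b, |b - a| ≤ L → |f a b - f a ((a + b) / 2) - f ((a + b) / 2) b| ≤ K * |b - a| ^ θ)
    (a b : ℝ) (hab : |b - a| ≤ L) :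
    |f a b| ≤ (1 - (2 : ℝ) ^ (1 - θ))⁻¹ * K * |b - a| ^ θ := by
  have h2 : (2 : ℝ) ^ (1 - θ) < 1 := Real.rpow_lt_one_of_one_lt_of_neg (by norm_num) (by linarith)
  set C := (1 - (2 : ℝ) ^ (1 - θ))⁻¹ with hC
  have hCeq : 1 + C * (2 : ℝ) ^ (1 - θ) = C := by
    have : 1 - (2 : ℝ) ^ (1 - θ) ≠ 0 := by linarith
    rw [hC]; field_simp; ring
  have key : ∀ n : ℕ, ∀ a b, |b - a| ≤ L → |f a b| ≤ C * K * |b - a| ^ θ + M * (1 / 2) ^ n * |b - a| ^ 2 := by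
    intro n
    induction n with
    | zero =>
      intro a b hab
      have h1 := hM a b hab
      have hCpos : 0 < C := inv_pos.2 (by linarith)
      have : 0 ≤ C * K * |b - a| ^ θ := by positivity
      rw [pow_zero, mul_one]; linarith
    | succ n ih =>
      intro a b hab
      have e1 : |(a + b) / 2 - a| = |b - a| / 2 := by
        rw [show (a + b) / 2 - a = (b - a) / 2 by ring, abs_div]; norm_num
      have e2 : |b - (a + b) / 2| = |b - a| / 2 := by
        rw [show b - (a + b) / 2 = (b - a) / 2 by ring, abs_div]; norm_num
      have hp := abs_nonneg (b - a)
      have i1 := ih a ((a + b) / 2) (by rw [e1]; linarith)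
      have i2 := ih ((a + b) / 2) b (by rw [e2]; linarith)
      rw [e1] at i1
      rw [e2] at i2
      have h3 := hf a b hab
      have h4 : |f a b| ≤ |f a b - f a ((a + b) / 2) - f ((a + b) / 2) b| + |f a ((a + b) / 2)| + |f ((a + b) / 2) b| := by
        have := abs_add_three (f a b - f a ((a + b) / 2) - f ((a + b) / 2) b) (f a ((a + b) / 2)) (f ((a + b) / 2) b)
        refine le_trans (le_of_eq ?_) this
        congr 1; ring
      have h5 : (|b - a| / 2) ^ θ * 2 = |b - a| ^ θ * (2 : ℝ) ^ (1 - θ) := by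
        rw [Real.div_rpow hp (by norm_num), Real.rpow_sub (by norm_num), Real.rpow_one]
        field_simp
      have h6 : K * |b - a| ^ θ + 2 * (C * K * (|b - a| / 2) ^ θ) = C * K * |b - a| ^ θ := by
        calc _ = K * |b - a| ^ θ + C * K * ((|b - a| / 2) ^ θ * 2) := by ring
          _ = (1 + C * (2 : ℝ) ^ (1 - θ)) * K * |b - a| ^ θ := by rw [h5]; ring
          _ = _ := by rw [hCeq]
      have h7 : 2 * (M * (1 / 2) ^ n * (|b - a| / 2) ^ 2) = M * (1 / 2) ^ (n + 1) * |b - a| ^ 2 := by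
        ring
      linarith
  have lim : Filter.Tendsto (fun n : ℕ => C * K * |b - a| ^ θ + M * (1 / 2) ^ n * |b - a| ^ 2)
      Filter.atTop (nhds (C * K * |b - a| ^ θ + M * 0 * |b - a| ^ 2)) := by
    refine Filter.Tendsto.const_add _ (Filter.Tendsto.mul_const _ (Filter.Tendsto.const_mul _ ?_))
    exact tendsto_pow_atTop_nhds_zero_of_lt_one (by norm_num) (by norm_num)
  have := ge_of_tendsto' lim (fun n => key n a b hab)
  simpa using this

section tri
variable {F : ℝ × ℝ → ℝ}

/-- Lower triangle integral (`-Duh`). -/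
def triD (F : ℝ × ℝ → ℝ) (a b : ℝ) : ℝ := ∫ v' in a..b, ∫ u' in a..v', F (u', v')

def triE (F : ℝ × ℝ → ℝ) (a b : ℝ) : ℝ := ∫ u' in a..b, ∫ v' in u'..b, F (u', v')

def rectI (F : ℝ × ℝ → ℝ) (a b c d : ℝ) : ℝ := ∫ v' in c..d, ∫ u' in a..b, F (u', v')

lemma cont_inner (hF : Continuous F) (a : ℝ) : Continuous fun v' : ℝ => ∫ u' in a..v', F (u', v') := by
  apply intervalIntegral.continuous_parametric_intervalIntegral_of_continuous (f := fun v' u' => F (u', v'))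
  · fun_prop
  · fun_prop

lemma cont_inner2 (hF : Continuous F) (a b : ℝ) : Continuous fun v' : ℝ => ∫ u' in a..b, F (u', v') := by
  apply intervalIntegral.continuous_parametric_intervalIntegral_of_continuous (f := fun v' u' => F (u', v'))
  · fun_prop
  · fun_prop

lemma cont_inner' (hF : Continuous F) (b : ℝ) : Continuous fun u' : ℝ => ∫ v' in u'..b, F (u', v') := by
  have : (fun u' : ℝ => ∫ v' in u'..b, F (u', v')) = fun u' : ℝ => - ∫ v' in b..u', F (u', v') := by
    funext u'
    rw [intervalIntegral.integral_symm]
  rw [this]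
  apply Continuous.neg
  apply intervalIntegral.continuous_parametric_intervalIntegral_of_continuous (f := fun u' v' => F (u', v'))
  · fun_prop
  · fun_prop

lemma cont_inner2' (hF : Continuous F) (a b : ℝ) : Continuous fun u' : ℝ => ∫ v' in a..b, F (u', v') := by
  apply intervalIntegral.continuous_parametric_intervalIntegral_of_continuous (f := fun u' v' => F (u', v'))
  · fun_prop
  · fun_prop

lemma triD_cocycle (hF : Continuous F) (a c b : ℝ) :
    triD F a b = triD F a c + triD F c b + rectI F a c c b := by
  unfold triD rectI
  rw [← intervalIntegral.integral_add_adjacent_intervals (b := c)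
    ((cont_inner hF a).intervalIntegrable _ _) ((cont_inner hF a).intervalIntegrable _ _), add_assoc,
    ← intervalIntegral.integral_add ((cont_inner hF c).intervalIntegrable _ _)
      ((cont_inner2 hF a c).intervalIntegrable _ _)]
  congr 1
  apply intervalIntegral.integral_congr
  intro v _
  simp only
  rw [add_comm, intervalIntegral.integral_add_adjacent_intervals] <;>
  exact Continuous.intervalIntegrable (by fun_prop) _ _

lemma rectI_swap (hF : Continuous F) (a b c d : ℝ) :
    rectI F a b c d = ∫ u' in a..b, ∫ v' in c..d, F (u', v') := by
  unfold rectI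
  apply intervalIntegral_intervalIntegral_swap (F := fun v' u' => F (u', v'))
  have : Continuous (Function.uncurry fun v' u' : ℝ => F (u', v')) := by fun_prop
  have h2 : IntegrableOn (Function.uncurry fun v' u' : ℝ => F (u', v')) (Set.uIcc c d ×ˢ Set.uIcc a b) :=
    this.continuousOn.integrableOn_compact (isCompact_uIcc.prod isCompact_uIcc)
  exact h2.mono_set (Set.prod_mono Set.uIoc_subset_uIcc Set.uIoc_subset_uIcc)

lemma triE_cocycle (hF : Continuous F) (a c b : ℝ) :
    triE F a b = triE F a c + triE F c b + rectI F a c c b := by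
  rw [rectI_swap hF]
  unfold triE
  rw [← intervalIntegral.integral_add_adjacent_intervals (b := c)
    ((cont_inner' hF b).intervalIntegrable _ _) ((cont_inner' hF b).intervalIntegrable _ _),
    add_right_comm,
    ← intervalIntegral.integral_add ((cont_inner' hF c).intervalIntegrable _ _)
      ((cont_inner2' hF c b).intervalIntegrable _ _)]
  congr 1
  apply intervalIntegral.integral_congr
  intro v _
  simp only
  rw [intervalIntegral.integral_add_adjacent_intervals] <;>
  exact Continuous.intervalIntegrable (by fun_prop) _ _

lemma triD_bound {B : ℝ} (hB : ∀ p, |F p| ≤ B) (a b : ℝ) : |triD F a b| ≤ B * |b - a| ^ 2 := by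
  have hB0 : 0 ≤ B := (abs_nonneg _).trans (hB 0)
  have : ‖triD F a b‖ ≤ (B * |b - a|) * |b - a| := by
    apply intervalIntegral.norm_integral_le_of_norm_le_const
    intro v hv
    refine (intervalIntegral.norm_integral_le_of_norm_le_const (C := B) fun u _ => hB _).trans ?_
    refine mul_le_mul_of_nonneg_left ?_ hB0
    have := Set.abs_sub_left_of_mem_uIcc (Set.uIoc_subset_uIcc hv)
    exact this
  rw [Real.norm_eq_abs] at this
  linarith [this]

lemma triE_bound {B : ℝ} (hB : ∀ p, |F p| ≤ B) (a b : ℝ) : |triE F a b| ≤ B * |b - a| ^ 2 := by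
  have hB0 : 0 ≤ B := (abs_nonneg _).trans (hB 0)
  have : ‖triE F a b‖ ≤ (B * |b - a|) * |b - a| := by
    apply intervalIntegral.norm_integral_le_of_norm_le_const
    intro v hv
    refine (intervalIntegral.norm_integral_le_of_norm_le_const (C := B) fun u _ => hB _).trans ?_
    refine mul_le_mul_of_nonneg_left ?_ hB0
    have := Set.abs_sub_right_of_mem_uIcc (Set.uIoc_subset_uIcc hv)
    exact this
  rw [Real.norm_eq_abs] at this
  linarith [this]

lemma triD_eq_triE (hF : Continuous F) {B : ℝ} (hB : ∀ p, |F p| ≤ B) (a b : ℝ) :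
    triD F a b = triE F a b := by
  have := sewing_bisect (f := fun a b => triD F a b - triE F a b) (K := 0) (M := 2 * B) (θ := 2)
    (L := |b - a|)
    (by norm_num) le_rfl ?_ ?_ a b le_rfl
  · simp at this
    linarith
  · intro a b _
    have h1 := triD_bound hB a b
    have h2 := triE_bound hB a b
    have := abs_sub (triD F a b) (triE F a b)
    linarith
  · intro a b _
    rw [triD_cocycle hF a ((a + b) / 2) b, triE_cocycle hF a ((a + b) / 2) b]
    simp only [zero_mul]
    apply le_of_eq
    rw [abs_eq_zero]
    ring

lemma duh_eq (F : ℝ × ℝ → ℝ) (u v : ℝ) : Duh F (u, v) = - triD F u v := rfl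

lemma hasDerivAt_duh_v (hF : Continuous F) (u v : ℝ) :
    HasDerivAt (fun v => Duh F (u, v)) (-∫ u' in u..v, F (u', v)) v := by
  have := ((cont_inner hF u).integral_hasStrictDerivAt u v).hasDerivAt
  exact this.neg

lemma hasDerivAt_duh_u (hF : Continuous F) {B : ℝ} (hB : ∀ p, |F p| ≤ B) (u v : ℝ) :
    HasDerivAt (fun u => Duh F (u, v)) (∫ v' in u..v, F (u, v')) u := by
  have h : (fun u => Duh F (u, v)) = fun u => ∫ u' in v..u, ∫ v' in u'..v, F (u', v') := by
    funext u
    rw [duh_eq, triD_eq_triE hF hB, triE, intervalIntegral.integral_symm u v]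
  rw [h]
  exact ((cont_inner' hF v).integral_hasStrictDerivAt v u).hasDerivAt

end tri



lemma contDiff_param_aux {E : Type} [NormedAddCommGroup E] [NormedSpace ℝ E] [FiniteDimensional ℝ E] (n : ℕ) :
    ∀ {G : Type} [NormedAddCommGroup G] [NormedSpace ℝ G] [CompleteSpace G] {f : E × ℝ → G},
    ContDiff ℝ n f → ContDiff ℝ n (fun x => ∫ t in (0:ℝ)..1, f (x, t)) := by
  haveI : ProperSpace E := FiniteDimensional.proper ℝ E
  induction n with
  | zero =>
    intro G _ _ _ f hf
    have hf' : Continuous f := hf.continuous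
    apply ContDiff.of_le (n := 0) _ (by simp)
    rw [contDiff_zero]
    apply intervalIntegral.continuous_parametric_intervalIntegral_of_continuous' (f := fun x t => f (x, t))
    fun_prop
  | succ n ih =>
    intro G _ _ _ f hf
    have hf1 : ContDiff ℝ ((n : ℕ) + 1 : ℕ) f := hf
    have hc : Continuous f := hf.continuous
    have hd : ContDiff ℝ n (fderiv ℝ f) := hf.fderiv_right (by norm_cast)
    set f' : E × ℝ → E →L[ℝ] G := fun q => (fderiv ℝ f q).comp (ContinuousLinearMap.inl ℝ E ℝ) with hf'
    have hf'c : ContDiff ℝ n f' := hd.clm_comp contDiff_const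
    have hf'c0 : Continuous f' := hf'c.continuous
    have hder : ∀ x, HasFDerivAt (fun x => ∫ t in (0:ℝ)..1, f (x, t)) (∫ t in (0:ℝ)..1, f' (x, t)) x := by
      intro x
      obtain ⟨M, hM⟩ := ((isCompact_closedBall x 1).prod (isCompact_Icc (a := (0:ℝ)) (b := 1))).exists_bound_of_continuousOn hf'c0.continuousOn
      have := intervalIntegral.hasFDerivAt_integral_of_dominated_of_fderiv_le (μ := volume) (a := 0) (b := 1)
        (F := fun x t => f (x, t)) (F' := fun x t => f' (x, t)) (x₀ := x) (s := Metric.ball x 1)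
        (bound := fun _ => M) (Metric.ball_mem_nhds x one_pos) ?_ ?_ ?_ ?_ ?_ ?_
      · exact this
      · filter_upwards with y
        exact Continuous.aestronglyMeasurable (by fun_prop)
      · exact Continuous.intervalIntegrable (by fun_prop) _ _
      · exact Continuous.aestronglyMeasurable (by fun_prop)
      · filter_upwards with t ht y hy
        apply hM
        refine ⟨Metric.ball_subset_closedBall hy, ?_⟩
        rw [Set.uIoc_of_le zero_le_one] at ht
        exact ⟨ht.1.le, ht.2⟩
      · exact intervalIntegrable_const
      · filter_upwards with t ht y hy
        have h1 : HasFDerivAt f (fderiv ℝ f (y, t)) (y, t) :=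
          ((hf.differentiable (by simp)) (y, t)).hasFDerivAt
        exact h1.comp y (hasFDerivAt_prodMk_left y t)
    have : ((n + 1 : ℕ) : WithTop ℕ∞) = (n : WithTop ℕ∞) + 1 := by norm_cast
    rw [this, contDiff_succ_iff_hasFDerivAt]
    exact ⟨_, ih hf'c, hder⟩

lemma contDiff_param {E : Type} [NormedAddCommGroup E] [NormedSpace ℝ E] [FiniteDimensional ℝ E]
    {f : E × ℝ → ℝ} (hf : ContDiff ℝ (⊤ : ℕ∞) f) :
    ContDiff ℝ (⊤ : ℕ∞) (fun x => ∫ t in (0:ℝ)..1, f (x, t)) := by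
  rw [contDiff_infty]
  intro n
  exact contDiff_param_aux n (hf.of_le (by exact_mod_cast le_top))

lemma integral_unit (g : ℝ → ℝ) (a b : ℝ) :
    ∫ x in a..b, g x = (b - a) * ∫ s in (0:ℝ)..1, g (a + (b - a) * s) := by
  have := intervalIntegral.smul_integral_comp_add_mul (a := 0) (b := 1) g (b - a) a
  rw [smul_eq_mul] at this
  rw [this]
  simp

lemma contDiff_duh {F : ℝ × ℝ → ℝ} (hF : ContDiff ℝ (⊤ : ℕ∞) F) :
    ContDiff ℝ (⊤ : ℕ∞) (fun p : ℝ × ℝ => Duh F p) := by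
  have h : (fun p : ℝ × ℝ => Duh F p) = fun p : ℝ × ℝ => -((p.2 - p.1) * ∫ s in (0:ℝ)..1,
      ((p.2 - p.1) * s) * ∫ t in (0:ℝ)..1, F (p.1 + ((p.2 - p.1) * s) * t, p.1 + (p.2 - p.1) * s)) := by
    funext p
    unfold Duh
    rw [integral_unit]
    congr 3
    funext s
    rw [integral_unit]
    simp
  rw [h]
  have h1 : ContDiff ℝ (⊤ : ℕ∞) (fun q : (ℝ × ℝ) × ℝ => ∫ t in (0:ℝ)..1,
      F (q.1.1 + ((q.1.2 - q.1.1) * q.2) * t, q.1.1 + (q.1.2 - q.1.1) * q.2)) := by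
    apply contDiff_param (f := fun r : ((ℝ × ℝ) × ℝ) × ℝ =>
      F (r.1.1.1 + ((r.1.1.2 - r.1.1.1) * r.1.2) * r.2, r.1.1.1 + (r.1.1.2 - r.1.1.1) * r.1.2))
    exact hF.comp (by fun_prop)
  have h2 : ContDiff ℝ (⊤ : ℕ∞) (fun p : ℝ × ℝ => ∫ s in (0:ℝ)..1,
      ((p.2 - p.1) * s) * ∫ t in (0:ℝ)..1, F (p.1 + ((p.2 - p.1) * s) * t, p.1 + (p.2 - p.1) * s)) := by
    apply contDiff_param (f := fun q : (ℝ × ℝ) × ℝ => ((q.1.2 - q.1.1) * q.2) * ∫ t in (0:ℝ)..1,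
      F (q.1.1 + ((q.1.2 - q.1.1) * q.2) * t, q.1.1 + (q.1.2 - q.1.1) * q.2))
    exact ContDiff.mul (by fun_prop) h1
  exact (ContDiff.mul (by fun_prop) h2).neg

lemma CbSmooth.bounded {F : ℝ × ℝ → ℝ} (hF : CbSmooth F) : ∃ B, ∀ p, |F p| ≤ B := by
  obtain ⟨C, hC⟩ := hF.2 0
  refine ⟨C, fun p => ?_⟩
  have := hC p
  rwa [norm_iteratedFDeriv_zero] at this

lemma duhamel_part1 (F : ℝ × ℝ → ℝ) (hF : CbSmooth F) :
      (∀ u v : ℝ, Duh F (u, v) = -∫ u' in u..v, ∫ v' in u'..v, F (u', v')) ∧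
      (ContDiff ℝ (⊤ : ℕ∞) (fun p : ℝ × ℝ => Duh F p) ∧
        ∀ u v : ℝ, deriv (fun u' => deriv (fun v' => Duh F (u', v')) v) u = F (u, v)) ∧
      (∀ x : ℝ, Duh F (x, x) = 0 ∧
        deriv (fun v => Duh F (x, v)) x - deriv (fun u => Duh F (u, x)) x = 0) := by
  have hc : Continuous F := hF.1.continuous
  obtain ⟨B, hB⟩ := hF.bounded
  refine ⟨fun u v => ?_, ⟨contDiff_duh hF.1, fun u v => ?_⟩, fun x => ⟨?_, ?_⟩⟩
  · rw [duh_eq, triD_eq_triE hc hB]; rfl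
  · have : (fun u' => deriv (fun v' => Duh F (u', v')) v) = fun u => ∫ u' in v..u, F (u', v) := by
      funext u
      rw [(hasDerivAt_duh_v hc u v).deriv, intervalIntegral.integral_symm, neg_neg]
    rw [this]
    have h2 : Continuous fun u' => F (u', v) := by fun_prop
    exact (h2.integral_hasStrictDerivAt v u).hasDerivAt.deriv
  · simp [Duh]
  · rw [(hasDerivAt_duh_v hc x x).deriv, (hasDerivAt_duh_u hc hB x x).deriv]
    simp



section kern
open scoped SchwartzMap FourierTransform

lemma invFourier_schwartz {g : ℝ → ℝ} (hg : ContDiff ℝ (⊤ : ℕ∞) g) {R : ℝ}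
    (hR : ∀ ξ, R ≤ |ξ| → g ξ = 0) (heven : ∀ ξ, g (-ξ) = g ξ) :
    ∃ S G : 𝓢(ℝ, ℂ), (∀ x, S x = (invFourier g x : ℂ)) ∧
      (∀ v, G v = (g (2 * π * v) : ℂ)) ∧ 𝓕 S = (√(2 * π) : ℂ) • G := by
  have hs : HasCompactSupport (fun v : ℝ => (g (2 * π * v) : ℂ)) := by
    apply HasCompactSupport.intro (isCompact_Icc (a := -(R / (2 * π))) (b := R / (2 * π)))
    intro x hx
    simp only [Complex.ofReal_eq_zero]
    apply hR
    by_contra hlt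
    push Not at hlt
    apply hx
    rw [abs_mul, abs_of_pos (by positivity : 0 < 2 * π)] at hlt
    rw [Set.mem_Icc, ← abs_le, le_div_iff₀ (by positivity)]
    linarith
  have hsm : ContDiff ℝ (⊤ : ℕ∞) (fun v : ℝ => (g (2 * π * v) : ℂ)) := by
    apply Complex.ofRealCLM.contDiff.comp
    exact hg.comp (by fun_prop)
  have hgc : HasCompactSupport g := by
    apply HasCompactSupport.intro (isCompact_Icc (a := -R) (b := R))
    intro x hx
    apply hR
    by_contra hlt
    push Not at hlt
    exact hx (abs_le.1 hlt.le)
  set G : 𝓢(ℝ, ℂ) := hs.toSchwartzMap hsm with hG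
  have hGv : ∀ v, G v = (g (2 * π * v) : ℂ) := fun v => rfl
  refine ⟨(√(2 * π) : ℂ) • 𝓕⁻ G, G, fun x => ?_, hGv, ?_⟩
  · have hcos : Integrable (fun ξ => Real.cos (x * ξ) * g ξ) :=
      Continuous.integrable_of_hasCompactSupport (by have := hg.continuous; fun_prop) hgc.mul_left
    have hsin : Integrable (fun ξ => Real.sin (x * ξ) * g ξ) :=
      Continuous.integrable_of_hasCompactSupport (by have := hg.continuous; fun_prop) hgc.mul_left
    have hsin0 : ∫ ξ, Real.sin (x * ξ) * g ξ = 0 := by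
      have h := integral_neg_eq_self (fun ξ => Real.sin (x * ξ) * g ξ) volume
      simp only [mul_neg, Real.sin_neg, heven, neg_mul] at h
      rw [integral_neg] at h
      linarith
    have h1 : (𝓕⁻ G) x = ∫ v : ℝ, Complex.exp (((x * (2 * π * v) : ℝ) : ℂ) * Complex.I) * (g (2 * π * v) : ℂ) := by
      rw [SchwartzMap.fourierInv_coe, Real.fourierInv_eq']
      congr 1
      funext v
      rw [hGv, smul_eq_mul]
      congr 2
      simp
      ring
    have h2 := Measure.integral_comp_mul_left (fun ξ : ℝ => Complex.exp (((x * ξ : ℝ) : ℂ) * Complex.I) * (g ξ : ℂ)) (2 * π)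
    have h3 : ∫ ξ : ℝ, Complex.exp (((x * ξ : ℝ) : ℂ) * Complex.I) * (g ξ : ℂ)
        = ((∫ ξ, Real.cos (x * ξ) * g ξ : ℝ) : ℂ) := by
      have : ∀ ξ : ℝ, Complex.exp (((x * ξ : ℝ) : ℂ) * Complex.I) * (g ξ : ℂ) =
        ((Real.cos (x * ξ) * g ξ : ℝ) : ℂ) + ((Real.sin (x * ξ) * g ξ : ℝ) : ℂ) * Complex.I := by
        intro ξ
        rw [Complex.exp_mul_I]
        push_cast
        ring
      simp_rw [this]
      rw [integral_add hcos.ofReal (hsin.ofReal.mul_const _), integral_mul_const, integral_complex_ofReal,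
        integral_complex_ofReal, hsin0]
      simp
    rw [smul_apply, h1, h2, h3, invFourier, abs_of_pos (by positivity)]
    rw [Complex.real_smul, smul_eq_mul, ← mul_assoc]
    push_cast
    congr 1
    have : √(2 * π) * (2 * π)⁻¹ = (√(2 * π))⁻¹ := by
      have h0 : √(2 * π) ≠ 0 := by positivity
      have h1 : √(2 * π) * √(2 * π) = 2 * π := Real.mul_self_sqrt (by positivity)
      rw [mul_inv_eq_iff_eq_mul₀ (by positivity), inv_mul_eq_div, eq_div_iff h0, h1]
    have h := congrArg (fun r : ℝ => (r : ℂ)) this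
    push_cast at h ⊢
    exact h
  · rw [FourierTransform.fourier_smul, FourierTransform.fourier_fourierInv_eq]


variable {ρ : ℝ → ℝ}

lemma IsLPCutoff.hcs (hρ : IsLPCutoff ρ) : HasCompactSupport ρ := by
  apply HasCompactSupport.intro (isCompact_Icc (a := -(9 / 8 : ℝ)) (b := 9 / 8))
  intro x hx
  apply hρ.eq_zero
  by_contra hlt
  push Not at hlt
  exact hx (abs_le.1 hlt.le)

lemma lpSymbol_succ (ρ : ℝ → ℝ) (k : ℕ) (ξ : ℝ) :
    lpSymbol ρ (k + 1) ξ = ρ (ξ / 2 ^ (k + 1)) - ρ (ξ / 2 ^ k) := by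
  simp only [lpSymbol]
  congr 2
  rw [pow_succ]
  field_simp

lemma lpSymbol_smooth (hρ : IsLPCutoff ρ) (k : ℕ) : ContDiff ℝ (⊤ : ℕ∞) (lpSymbol ρ k) := by
  cases k with
  | zero => exact hρ.smooth
  | succ k => exact (hρ.smooth.comp (by fun_prop)).sub (hρ.smooth.comp (by fun_prop))

lemma lpSymbol_even (hρ : IsLPCutoff ρ) (k : ℕ) (ξ : ℝ) : lpSymbol ρ k (-ξ) = lpSymbol ρ k ξ := by
  cases k with
  | zero => exact hρ.even ξ
  | succ k => rw [lpSymbol_succ, lpSymbol_succ, neg_div, neg_div, hρ.even, hρ.even]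

lemma lpSymbol_zero_of_le (hρ : IsLPCutoff ρ) (k : ℕ) (ξ : ℝ) (h : 9 / 8 * 2 ^ k ≤ |ξ|) : lpSymbol ρ k ξ = 0 := by
  cases k with
  | zero => exact hρ.eq_zero ξ (by simpa using h)
  | succ k =>
    rw [lpSymbol_succ, hρ.eq_zero, hρ.eq_zero, sub_zero]
    · rw [abs_div, abs_of_pos (by positivity : (0:ℝ) < 2 ^ k), le_div_iff₀ (by positivity)]
      refine le_trans ?_ h
      gcongr <;> norm_num
    · rw [abs_div, abs_of_pos (by positivity : (0:ℝ) < 2 ^ (k + 1)), le_div_iff₀ (by positivity)]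
      exact h

lemma invFourier_scale (g : ℝ → ℝ) (a : ℝ) (ha : 0 < a) (x : ℝ) :
    invFourier (fun ξ => g (ξ / a)) x = a * invFourier g (a * x) := by
  unfold invFourier
  have := Measure.integral_comp_div (fun ξ => Real.cos (a * x * ξ) * g ξ) a
  rw [abs_of_pos ha, smul_eq_mul] at this
  rw [mul_left_comm, ← this]
  congr 2
  funext ξ
  congr 2
  field_simp

lemma lpKernel_succ (hρ : IsLPCutoff ρ) (k : ℕ) (x : ℝ) :
    lpKernel ρ (k + 1) x = 2 ^ (k + 1) * lpKernel ρ 0 (2 ^ (k + 1) * x) - 2 ^ k * lpKernel ρ 0 (2 ^ k * x) := by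
  have h0 : lpKernel ρ 0 = invFourier ρ := rfl
  rw [h0, ← invFourier_scale _ _ (by positivity), ← invFourier_scale _ _ (by positivity)]
  unfold lpKernel invFourier
  rw [← mul_sub, ← integral_sub]
  · congr 2
    funext ξ
    rw [lpSymbol_succ, mul_sub]
  all_goals
    have := hρ.smooth.continuous
    refine Continuous.integrable_of_hasCompactSupport (by fun_prop) (HasCompactSupport.mul_left ?_)
    exact hρ.hcs.comp_homeomorph (Homeomorph.mulRight₀ (_ : ℝ)⁻¹ (by positivity))

lemma lpKernel_scale (hρ : IsLPCutoff ρ) (k : ℕ) (x : ℝ) :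
    lpKernel ρ (k + 1) x = 2 ^ k * lpKernel ρ 1 (2 ^ k * x) := by
  rw [lpKernel_succ hρ, lpKernel_succ hρ 0]
  ring_nf

lemma lpKernel0_cont (hρ : IsLPCutoff ρ) : Continuous (lpKernel ρ 0) := by
  obtain ⟨S, G, hS, -, -⟩ := invFourier_schwartz (lpSymbol_smooth hρ 0) (lpSymbol_zero_of_le hρ 0) (lpSymbol_even hρ 0)
  have : lpKernel ρ 0 = fun x => (S x).re := by
    funext x
    rw [hS]; rfl
  rw [this]
  have := S.continuous
  fun_prop

lemma lpKernel0_int_pow (hρ : IsLPCutoff ρ) (n : ℕ) : Integrable (fun x => |x| ^ n * |lpKernel ρ 0 x|) := by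
  obtain ⟨S, G, hS, -, -⟩ := invFourier_schwartz (lpSymbol_smooth hρ 0) (lpSymbol_zero_of_le hρ 0) (lpSymbol_even hρ 0)
  have := S.integrable_pow_mul volume n
  convert! this using 2
  rw [hS]
  simp [lpKernel]

lemma lpKernel0_integral (hρ : IsLPCutoff ρ) : ∫ x, lpKernel ρ 0 x = √(2 * π) := by
  obtain ⟨S, G, hS, hG, hSG⟩ := invFourier_schwartz (lpSymbol_smooth hρ 0) (lpSymbol_zero_of_le hρ 0) (lpSymbol_even hρ 0)
  have h1 : (𝓕 S) 0 = ∫ x, S x := by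
    rw [SchwartzMap.fourier_coe, Real.fourier_eq']
    simp
  rw [hSG, smul_apply, hG] at h1
  simp_rw [hS] at h1
  rw [integral_complex_ofReal] at h1
  have h2 : lpSymbol ρ 0 (2 * π * 0) = 1 := by
    rw [mul_zero]; exact hρ.eq_one 0 (by norm_num)
  rw [h2] at h1
  simp at h1
  have h3 : √(2 * π) = ∫ x, invFourier (lpSymbol ρ 0) x := by
    rw [Real.sqrt_mul (by norm_num)]
    exact_mod_cast h1
  exact h3.symm

/-- the reproducing identity -/
lemma lpKernel1_repro (hρ : IsLPCutoff ρ) : ∃ q q' : ℝ → ℝ, (∀ x, HasDerivAt q (q' x) x) ∧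
    Continuous q' ∧ Integrable q ∧ Integrable q' ∧
    ∀ x, lpKernel ρ 1 x = ∫ y, q' y * lpKernel ρ 1 (x - y) := by
  obtain ⟨S, G, hS, hG, hSG⟩ := invFourier_schwartz (lpSymbol_smooth hρ 1) (lpSymbol_zero_of_le hρ 1) (lpSymbol_even hρ 1)
  set θ : ℝ → ℝ := fun ξ => ρ (ξ / 4) - ρ (2 * ξ) with hθ
  have hθsm : ContDiff ℝ (⊤ : ℕ∞) θ := (hρ.smooth.comp (by fun_prop)).sub (hρ.smooth.comp (by fun_prop))
  have hθ0 : ∀ ξ, |ξ| ≤ 7 / 16 → θ ξ = 0 := by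
    intro ξ h
    simp only [hθ]
    rw [hρ.eq_one, hρ.eq_one, sub_self]
    · rw [abs_mul, abs_two]; linarith
    · rw [abs_div, abs_of_pos (by norm_num : (0:ℝ) < 4)]; linarith
  have hθ1 : ∀ ξ, lpSymbol ρ 1 ξ ≠ 0 → θ ξ = 1 := by
    intro ξ h
    have ha : |ξ| < 9 / 4 := by
      by_contra hh
      push Not at hh
      exact h (lpSymbol_zero_of_le hρ 1 ξ (by norm_num; linarith))
    have hb : 7 / 8 < |ξ| := by
      by_contra hh
      push Not at hh
      apply h
      rw [lpSymbol_succ, hρ.eq_one, hρ.eq_one, sub_self]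
      · simpa using hh
      · rw [abs_div]; norm_num; linarith
    simp only [hθ]
    rw [hρ.eq_one, hρ.eq_zero, sub_zero]
    · rw [abs_mul, abs_two]; linarith
    · rw [abs_div, abs_of_pos (by norm_num : (0:ℝ) < 4)]; linarith
  have hθ2 : ∀ ξ, 9 / 2 ≤ |ξ| → θ ξ = 0 := by
    intro ξ h
    simp only [hθ]
    rw [hρ.eq_zero, hρ.eq_zero, sub_self]
    · rw [abs_mul, abs_two]; linarith
    · rw [abs_div, abs_of_pos (by norm_num : (0:ℝ) < 4)]; linarith
  -- the multiplier
  set m : ℝ → ℂ := fun v => ((θ (2 * π * v) * (2 * π * v)⁻¹ : ℝ) : ℂ) * (-Complex.I) with hm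
  have hmr : ContDiff ℝ (⊤ : ℕ∞) (fun ξ : ℝ => θ ξ * ξ⁻¹) := by
    rw [contDiff_iff_contDiffAt]
    intro ξ
    by_cases h : ξ = 0
    · have : (fun ξ : ℝ => θ ξ * ξ⁻¹) =ᶠ[nhds ξ] fun _ => 0 := by
        rw [h]
        filter_upwards [Metric.closedBall_mem_nhds (0 : ℝ) (by norm_num : (0:ℝ) < 7 / 16)] with y hy
        rw [hθ0, zero_mul]
        simpa using hy
      exact contDiffAt_const.congr_of_eventuallyEq this
    · exact hθsm.contDiffAt.mul (contDiffAt_inv ℝ h)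
  have hmsm : ContDiff ℝ (⊤ : ℕ∞) m := by
    refine ContDiff.mul ?_ contDiff_const
    apply Complex.ofRealCLM.contDiff.comp
    exact hmr.comp (g := fun ξ : ℝ => θ ξ * ξ⁻¹) (f := fun v => 2 * π * v) (by fun_prop)
  have hms : HasCompactSupport m := by
    apply HasCompactSupport.intro (isCompact_Icc (a := -((9 / 2) / (2 * π))) (b := (9 / 2) / (2 * π)))
    intro x hx
    have : θ (2 * π * x) = 0 := by
      apply hθ2
      by_contra hlt
      push Not at hlt
      apply hx
      rw [abs_mul, abs_of_pos (by positivity : 0 < 2 * π)] at hlt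
      rw [Set.mem_Icc, ← abs_le, le_div_iff₀ (by positivity)]
      linarith
    simp only [hm, this]
    simp
  set M : 𝓢(ℝ, ℂ) := hms.toSchwartzMap hmsm with hM
  have hMv : ∀ v, M v = m v := fun v => rfl
  set Θ : 𝓢(ℝ, ℂ) := (2 * π * Complex.I) • SchwartzMap.smulLeftCLM ℂ (inner ℝ · (1:ℝ)) M with hΘ
  have hΘv : ∀ v, Θ v = (θ (2 * π * v) : ℂ) := by
    intro v
    have : (inner ℝ · (1:ℝ) : ℝ → ℝ).HasTemperateGrowth := by fun_prop
    rw [hΘ, smul_apply, SchwartzMap.smulLeftCLM_apply_apply this, hMv, hm]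
    simp only [smul_eq_mul, Complex.real_smul]
    by_cases hv : v = 0
    · rw [hv, hθ0 (2 * π * 0) (by simp; norm_num)]; simp
    · push_cast
      simp
      have : (π : ℂ) ≠ 0 := by exact_mod_cast Real.pi_ne_zero
      have : (v : ℂ) ≠ 0 := by exact_mod_cast hv
      field_simp
      simp
  set Q : 𝓢(ℝ, ℂ) := 𝓕⁻ M with hQ
  set Q' : 𝓢(ℝ, ℂ) := 𝓕⁻ Θ with hQ'
  have hline : LineDeriv.lineDerivOp (1:ℝ) Q = Q' := SchwartzMap.lineDerivOp_fourierInv_eq M 1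
  have hder : ∀ x, HasDerivAt Q (Q' x) x := by
    intro x
    rw [← hline]
    have h1 := (Q.differentiableAt (x := x)).hasDerivAt
    have h2 : (LineDeriv.lineDerivOp (1:ℝ) Q) x = deriv Q x := by
      rw [SchwartzMap.lineDerivOp_apply_eq_fderiv]
      simp
    rw [h2]
    exact h1
  have hconv : ∀ x, S x = ∫ y, Q' y * S (x - y) := by
    intro x
    have h1 := SchwartzMap.convolution_apply (ContinuousLinearMap.mul ℂ ℂ) Q' S x
    have h2 : SchwartzMap.convolution (ContinuousLinearMap.mul ℂ ℂ) Q' S = S := by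
      have h3 : 𝓕 (SchwartzMap.convolution (ContinuousLinearMap.mul ℂ ℂ) Q' S) = 𝓕 S := by
        rw [SchwartzMap.fourier_convolution, hQ', FourierTransform.fourier_fourierInv_eq, hSG]
        ext v
        rw [SchwartzMap.pairing_apply_apply, hΘv, smul_apply, hG]
        simp only [ContinuousLinearMap.mul_apply', smul_eq_mul]
        by_cases hz : lpSymbol ρ 1 (2 * π * v) = 0
        · rw [hz]; simp
        · rw [hθ1 _ hz]; simp
      have h4 := congrArg (fun T : 𝓢(ℝ, ℂ) => 𝓕⁻ T) h3
      simpa using h4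
    rw [h2] at h1
    rw [h1]
    rfl
  refine ⟨fun x => (Q x).re, fun x => (Q' x).re, fun x => ?_, ?_, ?_, ?_, fun x => ?_⟩
  · exact Complex.reCLM.hasFDerivAt.comp_hasDerivAt x (hder x)
  · have := Q'.continuous
    fun_prop
  · exact Q.integrable.re
  · exact Q'.integrable.re
  · have h1 := hconv x
    rw [hS] at h1
    have hQint : Integrable fun y => Q' y * S (x - y) := by
      refine (S.integrable.comp_sub_left x).bdd_mul (c := SchwartzMap.seminorm ℝ 0 0 Q') Q'.continuous.aestronglyMeasurable ?_
      exact Filter.Eventually.of_forall fun y => SchwartzMap.norm_le_seminorm ℝ Q' y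
    have h2 := congrArg Complex.re h1
    rw [Complex.ofReal_re, ← RCLike.re_eq_complex_re, ← integral_re hQint] at h2
    rw [lpKernel, h2]
    congr 1
    funext y
    rw [hS]
    simp

end kern



section gen

lemma int_mul_bdd {K f : ℝ → ℝ} {B : ℝ} (hK : Integrable K) (hf : Continuous f) (hB : ∀ x, |f x| ≤ B) :
    Integrable (fun y => K y * f y) :=
  hK.mul_bdd hf.aestronglyMeasurable (Filter.Eventually.of_forall hB)

lemma abs_int_mul_le {K f : ℝ → ℝ} {B : ℝ} (hK : Integrable K) (hB : ∀ x, |f x| ≤ B) :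
    |∫ y, K y * f y| ≤ (∫ y, |K y|) * B := by
  rw [← integral_mul_const, ← Real.norm_eq_abs]
  refine norm_integral_le_of_norm_le (hK.abs.mul_const B) (Filter.Eventually.of_forall fun y => ?_)
  rw [Real.norm_eq_abs, abs_mul]
  exact mul_le_mul_of_nonneg_left (hB y) (abs_nonneg _)

lemma fubK {K : ℝ → ℝ} {Φ : ℝ × ℝ → ℝ} {B : ℝ} (hK : Integrable K) (hΦ : Continuous Φ)
    (hB : ∀ p, |Φ p| ≤ B) (a b : ℝ) :
    ∫ x in a..b, ∫ y, K y * Φ (x, y) = ∫ y, K y * ∫ x in a..b, Φ (x, y) := by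
  rw [intervalIntegral_integral_swap]
  · simp_rw [intervalIntegral.integral_const_mul]
  · haveI : IsFiniteMeasure ((volume : Measure ℝ).restrict (Set.uIoc a b)) :=
      ⟨by simp [Set.uIoc]⟩
    have h1 : Integrable (fun z : ℝ × ℝ => (1 : ℝ) * K z.2) ((volume.restrict (Set.uIoc a b)).prod volume) :=
      Integrable.mul_prod (f := fun _ : ℝ => (1:ℝ)) (integrable_const 1) hK
    have h2 := h1.mul_bdd (g := Φ) (c := B) hΦ.aestronglyMeasurable (Filter.Eventually.of_forall hB)
    refine h2.congr (Filter.Eventually.of_forall fun z => ?_)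
    simp [Function.uncurry]

lemma contK {X : Type*} [TopologicalSpace X] [FirstCountableTopology X] {K : ℝ → ℝ} {Φ : X × ℝ → ℝ} {B : ℝ}
    (hK : Integrable K) (hΦ : Continuous Φ) (hB : ∀ p, |Φ p| ≤ B) :
    Continuous fun x => ∫ y, K y * Φ (x, y) := by
  refine continuous_of_dominated (bound := fun y => |K y| * B) ?_ ?_ (hK.abs.mul_const B) ?_
  · intro x
    have : Continuous fun y => Φ (x, y) := by fun_prop
    exact hK.aestronglyMeasurable.mul this.aestronglyMeasurable
  · intro x
    refine Filter.Eventually.of_forall fun y => ?_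
    rw [Real.norm_eq_abs, abs_mul]
    exact mul_le_mul_of_nonneg_left (hB _) (abs_nonneg _)
  · refine Filter.Eventually.of_forall fun y => ?_
    fun_prop

lemma conv_assoc {p K f : ℝ → ℝ} {B : ℝ} (hp : Integrable p) (hK : Integrable K)
    (hf : Continuous f) (hB : ∀ x, |f x| ≤ B) (x : ℝ) :
    ∫ y, (∫ w, p w * K (y - w)) * f (x - y) = ∫ w, p w * ∫ y, K y * f (x - w - y) := by
  have h1 : Integrable (fun z : ℝ × ℝ => p z.2 * K (z.1 - z.2)) (volume.prod volume) :=
    Integrable.convolution_integrand (ContinuousLinearMap.mul ℝ ℝ) hp hK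
  have h2 : Integrable (fun z : ℝ × ℝ => p z.2 * K (z.1 - z.2) * f (x - z.1)) (volume.prod volume) := by
    refine h1.mul_bdd (g := fun z : ℝ × ℝ => f (x - z.1)) (c := B) ?_ (Filter.Eventually.of_forall fun z => hB _)
    exact Continuous.aestronglyMeasurable (by fun_prop)
  calc ∫ y, (∫ w, p w * K (y - w)) * f (x - y)
      = ∫ y, ∫ w, p w * K (y - w) * f (x - y) := by simp_rw [integral_mul_const]
    _ = ∫ w, ∫ y, p w * K (y - w) * f (x - y) :=
        integral_integral_swap (f := fun y w => p w * K (y - w) * f (x - y)) h2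
    _ = _ := by
      congr 1
      funext w
      rw [← integral_const_mul, ← integral_sub_right_eq_self (fun y => p w * (K y * f (x - w - y))) w]
      congr 1
      funext y
      rw [show x - w - (y - w) = x - y by ring]
      ring

end gen

section ker
variable {ρ : ℝ → ℝ}

lemma lpKernel_cont (hρ : IsLPCutoff ρ) (k : ℕ) : Continuous (lpKernel ρ k) := by
  cases k with
  | zero => exact lpKernel0_cont hρ
  | succ k =>
    have h : lpKernel ρ (k + 1) = _ := funext (lpKernel_succ hρ k)
    rw [h]
    have := lpKernel0_cont hρ
    fun_prop

lemma lpKernel0_mom (hρ : IsLPCutoff ρ) {γ : ℝ} (h0 : 0 ≤ γ) (h1 : γ ≤ 1) :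
    Integrable (fun y => |y| ^ γ * |lpKernel ρ 0 y|) := by
  refine ((lpKernel0_int_pow hρ 0).add (lpKernel0_int_pow hρ 1)).mono' ?_ ?_
  · have := lpKernel0_cont hρ
    exact (((measurable_id.abs.pow_const γ)).mul (this.measurable.abs)).aestronglyMeasurable
  · refine Filter.Eventually.of_forall fun y => ?_
    have hy := abs_nonneg y
    have hr : |y| ^ γ ≤ 1 + |y| := by
      rcases le_total |y| 1 with h | h
      · have := Real.rpow_le_one hy h h0
        linarith
      · have := Real.rpow_le_rpow_of_exponent_le h h1
        rw [Real.rpow_one] at this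
        linarith
    have hn : 0 ≤ |y| ^ γ := Real.rpow_nonneg hy γ
    rw [Real.norm_eq_abs, abs_of_nonneg (by positivity)]
    simp only [Pi.add_apply]
    nlinarith [abs_nonneg (lpKernel ρ 0 y)]

lemma scaled_mom {K : ℝ → ℝ} {γ : ℝ} (hK : Integrable (fun y => |y| ^ γ * |K y|)) {a : ℝ} (ha : 0 < a) :
    Integrable (fun y => |y| ^ γ * |a * K (a * y)|) ∧
      ∫ y, |y| ^ γ * |a * K (a * y)| = a ^ (-γ) * ∫ y, |y| ^ γ * |K y| := by
  have e : (fun y => |y| ^ γ * |a * K (a * y)|) = fun y => (a ^ (-γ) * a) * (|a * y| ^ γ * |K (a * y)|) := by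
    funext y
    rw [abs_mul, abs_mul, abs_of_pos ha, Real.mul_rpow ha.le (abs_nonneg y), Real.rpow_neg ha.le]
    have : a ^ γ ≠ 0 := (Real.rpow_pos_of_pos ha γ).ne'
    field_simp
  rw [e]
  refine ⟨(hK.comp_mul_left' ha.ne').const_mul _, ?_⟩
  rw [integral_const_mul, Measure.integral_comp_mul_left (fun y => |y| ^ γ * |K y|), abs_of_pos (by positivity), smul_eq_mul]
  field_simp

lemma lpKernel_mom_int (hρ : IsLPCutoff ρ) {γ : ℝ} (h0 : 0 ≤ γ) (h1 : γ ≤ 1) (k : ℕ) :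
    Integrable (fun y => |y| ^ γ * |lpKernel ρ k y|) := by
  cases k with
  | zero => exact lpKernel0_mom hρ h0 h1
  | succ k =>
    have i1 := (scaled_mom (lpKernel0_mom hρ h0 h1) (a := 2 ^ (k + 1)) (by positivity)).1
    have i2 := (scaled_mom (lpKernel0_mom hρ h0 h1) (a := 2 ^ k) (by positivity)).1
    refine (i1.add i2).mono' ?_ ?_
    · have := lpKernel_cont hρ (k + 1)
      exact (((measurable_id.abs.pow_const γ)).mul (this.measurable.abs)).aestronglyMeasurable
    · refine Filter.Eventually.of_forall fun y => ?_
      rw [Real.norm_eq_abs, abs_of_nonneg (by positivity), lpKernel_succ hρ]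
      simp only [Pi.add_apply]
      rw [← mul_add]
      exact mul_le_mul_of_nonneg_left (abs_sub _ _) (by positivity)

lemma lpKernel_int (hρ : IsLPCutoff ρ) (k : ℕ) : Integrable (lpKernel ρ k) := by
  have := lpKernel_mom_int hρ le_rfl zero_le_one k
  simp only [Real.rpow_zero, one_mul] at this
  exact (integrable_norm_iff (lpKernel_cont hρ k).aestronglyMeasurable).1 this

lemma lpKernel_integral_succ (hρ : IsLPCutoff ρ) (k : ℕ) : ∫ y, lpKernel ρ (k + 1) y = 0 := by
  have h0 := lpKernel_int hρ 0
  have hs : ∀ a : ℝ, 0 < a → Integrable (fun y => a * lpKernel ρ 0 (a * y)) ∧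
      ∫ y, a * lpKernel ρ 0 (a * y) = ∫ y, lpKernel ρ 0 y := by
    intro a ha
    refine ⟨(h0.comp_mul_left' ha.ne').const_mul _, ?_⟩
    rw [integral_const_mul, Measure.integral_comp_mul_left (lpKernel ρ 0), abs_of_pos (by positivity), smul_eq_mul]
    field_simp
  simp_rw [lpKernel_succ hρ]
  rw [integral_sub (hs _ (by positivity)).1 (hs _ (by positivity)).1, (hs _ (by positivity)).2, (hs _ (by positivity)).2, sub_self]

lemma lpKernel_mom (hρ : IsLPCutoff ρ) {γ : ℝ} (h0 : 0 ≤ γ) (h1 : γ ≤ 1) :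
    ∃ C : ℝ, 0 ≤ C ∧ ∀ k : ℕ, ∫ y, |y| ^ γ * |lpKernel ρ k y| ≤ C * ((2 : ℝ) ^ k) ^ (-γ) := by
  set I0 := ∫ y, |y| ^ γ * |lpKernel ρ 0 y| with hI0
  set I1 := ∫ y, |y| ^ γ * |lpKernel ρ 1 y| with hI1
  have p0 : 0 ≤ I0 := integral_nonneg fun y => by positivity
  have p1 : 0 ≤ I1 := integral_nonneg fun y => by positivity
  refine ⟨I0 + 2 ^ γ * I1, by positivity, fun k => ?_⟩
  cases k with
  | zero =>
    simp only [pow_zero, Real.one_rpow, mul_one]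
    rw [← hI0]
    have : 0 ≤ 2 ^ γ * I1 := by positivity
    linarith
  | succ k =>
    have e0 : lpKernel ρ (k + 1) = fun y => 2 ^ k * lpKernel ρ 1 (2 ^ k * y) := funext (lpKernel_scale hρ k)
    rw [e0, (scaled_mom (lpKernel_mom_int hρ h0 h1 1) (by positivity)).2, ← hI1, pow_succ,
      Real.mul_rpow (by positivity) (by positivity), Real.rpow_neg (by norm_num : (0:ℝ) ≤ 2)]
    have h2 : (0:ℝ) < 2 ^ γ := by positivity
    have h3 : (0:ℝ) ≤ ((2:ℝ) ^ k) ^ (-γ) := by positivity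
    have h4 : (I0 + 2 ^ γ * I1) * (((2:ℝ) ^ k) ^ (-γ) * (2 ^ γ)⁻¹) = ((2:ℝ) ^ k) ^ (-γ) * I1 + ((2:ℝ) ^ k) ^ (-γ) * I0 * (2 ^ γ)⁻¹ := by
      field_simp
      ring
    rw [h4]
    have : 0 ≤ ((2:ℝ) ^ k) ^ (-γ) * I0 * (2 ^ γ)⁻¹ := by positivity
    linarith

/-- Hölder condition with a single constant. -/
def HolB (γ B : ℝ) (h : ℝ → ℝ) : Prop :=
  (∀ x, |h x| ≤ B) ∧ ∀ x y, |h x - h y| ≤ B * |x - y| ^ γ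

lemma HolB.continuous {γ B : ℝ} {h : ℝ → ℝ} (hγ : 0 < γ) (H : HolB γ B h) : Continuous h := by
  rw [continuous_iff_continuousAt]
  intro x
  rw [ContinuousAt, tendsto_iff_dist_tendsto_zero]
  refine squeeze_zero (fun _ => dist_nonneg) (fun y => H.2 y x) ?_
  have : Continuous fun y : ℝ => B * |y - x| ^ γ :=
    continuous_const.mul (Continuous.rpow_const (by fun_prop) (fun _ => Or.inr hγ.le))
  have := this.tendsto x
  simpa [Real.zero_rpow hγ.ne'] using this

lemma LP_holder (hρ : IsLPCutoff ρ) {γ : ℝ} (h0 : 0 < γ) (h1 : γ ≤ 1) :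
    ∃ C : ℝ, 0 ≤ C ∧ ∀ (h : ℝ → ℝ) (B : ℝ), HolB γ B h → ∀ k x, |LP ρ k h x| ≤ C * B * ((2 : ℝ) ^ k) ^ (-γ) := by
  obtain ⟨C, hC, hCk⟩ := lpKernel_mom hρ h0.le h1
  have p0 : 0 ≤ ∫ y, |lpKernel ρ 0 y| := integral_nonneg fun y => by positivity
  refine ⟨C + ∫ y, |lpKernel ρ 0 y|, by positivity, fun h B H k x => ?_⟩
  have hB : 0 ≤ B := (abs_nonneg _).trans (H.1 0)
  have hc := H.continuous h0
  cases k with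
  | zero =>
    have := abs_int_mul_le (lpKernel_int hρ 0) (f := fun y => h (x - y)) (B := B) (fun y => H.1 _)
    simp only [pow_zero, Real.one_rpow, mul_one]
    have hh : 0 ≤ C * B := by positivity
    unfold LP
    linarith
  | succ k =>
    have e : LP ρ (k + 1) h x = ∫ y, lpKernel ρ (k + 1) y * (h (x - y) - h x) := by
      simp_rw [mul_sub]
      rw [integral_sub, integral_mul_const, lpKernel_integral_succ hρ, zero_mul, sub_zero]
      · rfl
      · exact int_mul_bdd (lpKernel_int hρ _) (by fun_prop) (fun y => H.1 _)
      · exact (lpKernel_int hρ _).mul_const _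
    have e2 : |LP ρ (k + 1) h x| ≤ B * ∫ y, |y| ^ γ * |lpKernel ρ (k + 1) y| := by
      rw [e, ← integral_const_mul, ← Real.norm_eq_abs]
      refine norm_integral_le_of_norm_le ((lpKernel_mom_int hρ h0.le h1 _).const_mul B) (Filter.Eventually.of_forall fun y => ?_)
      rw [Real.norm_eq_abs, abs_mul]
      have := H.2 (x - y) x
      rw [show x - y - x = -y by ring, abs_neg] at this
      calc _ ≤ |lpKernel ρ (k + 1) y| * (B * |y| ^ γ) := mul_le_mul_of_nonneg_left this (abs_nonneg _)
        _ = _ := by ring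
    have e3 := mul_le_mul_of_nonneg_left (hCk (k + 1)) hB
    have e4 : 0 ≤ (∫ y, |lpKernel ρ 0 y|) * B * ((2 : ℝ) ^ (k + 1)) ^ (-γ) := by positivity
    nlinarith

end ker



section oneD
variable {ρ : ℝ → ℝ}

lemma LP_cont (hρ : IsLPCutoff ρ) (k : ℕ) {f : ℝ → ℝ} {B : ℝ} (hf : Continuous f) (hB : ∀ x, |f x| ≤ B) :
    Continuous (LP ρ k f) :=
  contK (Φ := fun p : ℝ × ℝ => f (p.1 - p.2)) (lpKernel_int hρ k) (by fun_prop) (fun _ => hB _)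

lemma lpKernel_repro_scaled (hρ : IsLPCutoff ρ) {q' : ℝ → ℝ}
    (h : ∀ x, lpKernel ρ 1 x = ∫ y, q' y * lpKernel ρ 1 (x - y)) (k : ℕ) (y : ℝ) :
    lpKernel ρ (k + 1) y = ∫ w, (2 ^ k * q' (2 ^ k * w)) * lpKernel ρ (k + 1) (y - w) := by
  have e0 : lpKernel ρ (k + 1) = fun y => 2 ^ k * lpKernel ρ 1 (2 ^ k * y) := funext (lpKernel_scale hρ k)
  rw [e0]
  have hs : (0:ℝ) < 2 ^ k := by positivity
  set s : ℝ := 2 ^ k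
  have e1 : (fun w => (s * q' (s * w)) * (s * lpKernel ρ 1 (s * (y - w)))) =
      fun w => s * s * (fun z => q' z * lpKernel ρ 1 (s * y - z)) (s * w) := by
    funext w
    simp only
    rw [mul_sub]
    ring
  show s * lpKernel ρ 1 (s * y) = ∫ w, (s * q' (s * w)) * (s * lpKernel ρ 1 (s * (y - w)))
  rw [e1, integral_const_mul, Measure.integral_comp_mul_left (fun z => q' z * lpKernel ρ 1 (s * y - z)), ← h,
    abs_of_pos (by positivity), smul_eq_mul]
  field_simp

lemma LP_repro_int (hρ : IsLPCutoff ρ) : ∃ C0 : ℝ, 0 ≤ C0 ∧ ∀ (k : ℕ) (f : ℝ → ℝ) (B D : ℝ), Continuous f →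
    (∀ x, |f x| ≤ B) → (∀ x, |LP ρ (k + 1) f x| ≤ D) → ∀ a b,
    |∫ x in a..b, LP ρ (k + 1) f x| ≤ C0 * ((2:ℝ) ^ k)⁻¹ * D := by
  obtain ⟨q, q', hq, hq'c, hqi, hq'i, hrep⟩ := lpKernel1_repro hρ
  have p0 : 0 ≤ ∫ y, |q y| := integral_nonneg fun y => abs_nonneg _
  refine ⟨2 * ∫ y, |q y|, by positivity, fun k f B D hf hB hD a b => ?_⟩
  have hs : (0:ℝ) < 2 ^ k := by positivity
  have hrk := lpKernel_repro_scaled hρ hrep k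
  set s : ℝ := 2 ^ k with hsdef
  set g := LP ρ (k + 1) f with hg
  have hgc : Continuous g := LP_cont hρ _ hf hB
  have hpi : Integrable (fun w => s * q' (s * w)) := (hq'i.comp_mul_left' hs.ne').const_mul _
  have hqsi : Integrable (fun w => q (s * w)) := hqi.comp_mul_left' hs.ne'
  have e1 : ∀ x, g x = ∫ w, (s * q' (s * w)) * g (x - w) := by
    intro x
    have := conv_assoc hpi (lpKernel_int hρ (k + 1)) hf hB x
    simp_rw [← hrk] at this
    exact this
  set H : ℝ → ℝ := fun w => ∫ x in a..b, g (x - w) with hH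
  have e2 : ∫ x in a..b, g x = ∫ w, H w * (s * q' (s * w)) := by
    have := fubK (Φ := fun p : ℝ × ℝ => g (p.1 - p.2)) hpi (by fun_prop) (fun _ => hD _) a b
    simp_rw [← e1] at this
    rw [this]
    congr 1
    funext w
    rw [mul_comm]
  have hHd : ∀ w, HasDerivAt H (g (a - w) - g (b - w)) w := by
    intro w
    have hG : ∀ t, HasDerivAt (fun t => ∫ x in (0:ℝ)..t, g x) (g t) t := fun t =>
      intervalIntegral.integral_hasDerivAt_right (hgc.intervalIntegrable _ _)
        (hgc.stronglyMeasurableAtFilter _ _) hgc.continuousAt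
    have e : H = fun w => (∫ x in (0:ℝ)..(b - w), g x) - ∫ x in (0:ℝ)..(a - w), g x := by
      funext w
      rw [intervalIntegral.integral_interval_sub_left (hgc.intervalIntegrable _ _) (hgc.intervalIntegrable _ _)]
      simp only [hH]
      rw [intervalIntegral.integral_comp_sub_right (fun x => g x)]
    rw [e]
    have h1 := (hG (b - w)).comp w ((hasDerivAt_id w).const_sub b)
    have h2 := (hG (a - w)).comp w ((hasDerivAt_id w).const_sub a)
    exact (h1.sub h2).congr_deriv (by ring)
  have hHc : Continuous H := continuous_iff_continuousAt.2 fun w => (hHd w).continuousAt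
  have hHb : ∀ w, |H w| ≤ D * |b - a| := by
    intro w
    rw [← Real.norm_eq_abs]
    exact intervalIntegral.norm_integral_le_of_norm_le_const fun x _ => hD _
  have hqd : ∀ w, HasDerivAt (fun w => q (s * w)) (s * q' (s * w)) w := by
    intro w
    have := (hq (s * w)).comp w ((hasDerivAt_id w).const_mul s)
    exact this.congr_deriv (by ring)
  have hdb : ∀ w, |g (a - w) - g (b - w)| ≤ 2 * D := by
    intro w
    have := abs_sub (g (a - w)) (g (b - w))
    have h1 := hD (a - w)
    have h2 := hD (b - w)
    linarith
  have e3 := integral_mul_deriv_eq_deriv_mul_of_integrable (u := H) (v := fun w => q (s * w)) (fun w _ => hHd w) (fun w _ => hqd w)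
    ((int_mul_bdd hpi hHc hHb).congr (Filter.Eventually.of_forall fun w => mul_comm _ _))
    ((int_mul_bdd hqsi (f := fun w => g (a - w) - g (b - w)) (by fun_prop) hdb).congr
      (Filter.Eventually.of_forall fun w => mul_comm _ _))
    ((int_mul_bdd hqsi hHc hHb).congr (Filter.Eventually.of_forall fun w => mul_comm _ _))
  rw [e2, e3, abs_neg]
  have e4 := abs_int_mul_le hqsi hdb
  have e5 : ∫ y, |q (s * y)| = s⁻¹ * ∫ y, |q y| := by
    rw [Measure.integral_comp_mul_left (fun z => |q z|), abs_of_pos (by positivity), smul_eq_mul]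
  rw [e5] at e4
  simp_rw [mul_comm (g (a - _) - g (b - _))]
  refine e4.trans (le_of_eq ?_)
  ring

lemma lpKernel_sum (hρ : IsLPCutoff ρ) (n : ℕ) (y : ℝ) :
    ∑ k ∈ Finset.range (n + 1), lpKernel ρ k y = 2 ^ n * lpKernel ρ 0 (2 ^ n * y) := by
  induction n with
  | zero => simp
  | succ n ih =>
    rw [Finset.sum_range_succ, ih, lpKernel_succ hρ]
    ring

lemma LP_sum_int (hρ : IsLPCutoff ρ) {f : ℝ → ℝ} {B : ℝ} (hf : Continuous f) (hB : ∀ x, |f x| ≤ B) (a b : ℝ) :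
    Filter.Tendsto (fun n : ℕ => ∑ k ∈ Finset.range (n + 1), ∫ x in a..b, LP ρ k f x) Filter.atTop
      (nhds (√(2 * π) * ∫ x in a..b, f x)) := by
  set W : ℝ → ℝ := fun y => ∫ x in a..b, f (x - y) with hW
  have hWc : Continuous W := by
    apply intervalIntegral.continuous_parametric_intervalIntegral_of_continuous'
    fun_prop
  have hWb : ∀ w, |W w| ≤ B * |b - a| := by
    intro w
    rw [← Real.norm_eq_abs]
    exact intervalIntegral.norm_integral_le_of_norm_le_const fun x _ => hB _
  have e1 : ∀ k, ∫ x in a..b, LP ρ k f x = ∫ y, lpKernel ρ k y * W y := fun k =>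
    fubK (Φ := fun p : ℝ × ℝ => f (p.1 - p.2)) (lpKernel_int hρ k) (by fun_prop) (fun _ => hB _) a b
  have e2 : ∀ n : ℕ, ∑ k ∈ Finset.range (n + 1), ∫ x in a..b, LP ρ k f x =
      ∫ z, lpKernel ρ 0 z * W (((2:ℝ) ^ n)⁻¹ * z) := by
    intro n
    have hs : (0:ℝ) < 2 ^ n := by positivity
    simp_rw [e1]
    rw [← integral_finsetSum _ fun k _ => int_mul_bdd (lpKernel_int hρ k) hWc hWb]
    simp_rw [← Finset.sum_mul, lpKernel_sum hρ]
    have := Measure.integral_comp_mul_left (fun z => lpKernel ρ 0 z * W (((2:ℝ) ^ n)⁻¹ * z)) (2 ^ n)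
    rw [abs_of_pos (by positivity), smul_eq_mul] at this
    have e3 : (∫ z, lpKernel ρ 0 z * W (((2:ℝ) ^ n)⁻¹ * z)) =
      2 ^ n * ∫ x, lpKernel ρ 0 (2 ^ n * x) * W (((2:ℝ) ^ n)⁻¹ * (2 ^ n * x)) := by
      rw [this]
      field_simp
    rw [e3, ← integral_const_mul]
    congr 1
    funext y
    rw [inv_mul_cancel_left₀ hs.ne']
    ring
  simp_rw [e2]
  have e4 : √(2 * π) * ∫ x in a..b, f x = ∫ z, lpKernel ρ 0 z * W 0 := by
    rw [integral_mul_const, lpKernel0_integral hρ]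
    simp [hW]
  rw [e4]
  refine tendsto_integral_of_dominated_convergence (fun z => |lpKernel ρ 0 z| * (B * |b - a|)) ?_ ?_ ?_ ?_
  · intro n
    have := lpKernel0_cont hρ
    exact Continuous.aestronglyMeasurable (by fun_prop)
  · exact (lpKernel_int hρ 0).abs.mul_const _
  · intro n
    refine Filter.Eventually.of_forall fun z => ?_
    rw [Real.norm_eq_abs, abs_mul]
    exact mul_le_mul_of_nonneg_left (hWb _) (abs_nonneg _)
  · refine Filter.Eventually.of_forall fun z => ?_
    refine Filter.Tendsto.const_mul _ ?_
    have h1 : Filter.Tendsto (fun n : ℕ => ((2:ℝ) ^ n)⁻¹ * z) Filter.atTop (nhds (0 * z)) := by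
      refine Filter.Tendsto.mul_const z ?_
      exact tendsto_inv_atTop_zero.comp (tendsto_pow_atTop_atTop_of_one_lt (by norm_num))
    rw [zero_mul] at h1
    exact (hWc.tendsto 0).comp h1

lemma min_sum_aux {γ : ℝ} (h0 : 0 < γ) (h1 : γ < 1) : ∃ C : ℝ, 0 ≤ C ∧ ∀ (n : ℕ) (h : ℝ), 0 < h →
    ∑ k ∈ Finset.range n, min ((2 ^ k * h) ^ (1 - γ)) ((2 ^ k * h) ^ (-γ)) ≤ C := by
  have c1 : (1:ℝ) < 2 ^ (1 - γ) := Real.one_lt_rpow (by norm_num) (by linarith)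
  have c2 : (2:ℝ) ^ (-γ) < 1 := Real.rpow_lt_one_of_one_lt_of_neg (by norm_num) (by linarith)
  set A : ℝ := (2 ^ (1 - γ) - 1)⁻¹ with hA
  set B : ℝ := (1 - 2 ^ (-γ))⁻¹ with hB
  have pA : 0 < A := inv_pos.2 (by linarith)
  have pB : 0 < B := inv_pos.2 (by linarith)
  set φ : ℝ → ℝ := fun x => A * (min x 2) ^ (1 - γ) - B * (max x 1) ^ (-γ) with hφ
  have key : ∀ x : ℝ, 0 < x → min (x ^ (1 - γ)) (x ^ (-γ)) ≤ φ (2 * x) - φ x := by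
    intro x hx
    have m1 : (min x 2) ^ (1 - γ) ≤ (min (2 * x) 2) ^ (1 - γ) := by
      apply Real.rpow_le_rpow (by positivity) _ (by linarith)
      exact min_le_min_right _ (by linarith)
    have m2 : (max (2 * x) 1) ^ (-γ) ≤ (max x 1) ^ (-γ) := by
      apply Real.rpow_le_rpow_of_nonpos (by positivity) _ (by linarith)
      exact max_le_max_right _ (by linarith)
    rcases le_or_gt x 1 with hx1 | hx1
    · refine (min_le_left _ _).trans ?_
      have : A * (min (2 * x) 2) ^ (1 - γ) - A * (min x 2) ^ (1 - γ) = x ^ (1 - γ) := by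
        rw [min_eq_left (by linarith), min_eq_left (by linarith), Real.mul_rpow (by norm_num) hx.le, hA]
        have : (2:ℝ) ^ (1 - γ) - 1 ≠ 0 := by linarith
        field_simp
      have := mul_le_mul_of_nonneg_left m2 pB.le
      simp only [hφ]
      linarith
    · refine (min_le_right _ _).trans ?_
      have : B * (max x 1) ^ (-γ) - B * (max (2 * x) 1) ^ (-γ) = x ^ (-γ) := by
        rw [max_eq_left (by linarith), max_eq_left (by linarith), Real.mul_rpow (by norm_num) hx.le, hB]
        have : 1 - (2:ℝ) ^ (-γ) ≠ 0 := by linarith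
        field_simp
      have := mul_le_mul_of_nonneg_left m1 pA.le
      simp only [hφ]
      linarith
  refine ⟨A * 2 ^ (1 - γ) + B, by positivity, fun n h hh => ?_⟩
  have tel : ∑ k ∈ Finset.range n, min ((2 ^ k * h) ^ (1 - γ)) ((2 ^ k * h) ^ (-γ)) ≤ φ (2 ^ n * h) - φ h := by
    induction n with
    | zero => simp
    | succ n ih =>
      rw [Finset.sum_range_succ]
      have := key (2 ^ n * h) (by positivity)
      rw [show 2 * (2 ^ n * h) = 2 ^ (n + 1) * h by ring] at this
      linarith
  refine tel.trans ?_
  have b1 : (min (2 ^ n * h) 2) ^ (1 - γ) ≤ (2:ℝ) ^ (1 - γ) :=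
    Real.rpow_le_rpow (by positivity) (min_le_right _ _) (by linarith)
  have b2 : (max h 1) ^ (-γ) ≤ 1 := Real.rpow_le_one_of_one_le_of_nonpos (le_max_right _ _) (by linarith)
  have b3 : 0 ≤ (max (2 ^ n * h) 1) ^ (-γ) := by positivity
  have b4 : 0 ≤ (min h 2) ^ (1 - γ) := by positivity
  simp only [hφ]
  nlinarith [mul_le_mul_of_nonneg_left b1 pA.le, mul_le_mul_of_nonneg_left b2 pB.le, mul_nonneg pB.le b3, mul_nonneg pA.le b4]

lemma min_sum {γ : ℝ} (h0 : 0 < γ) (h1 : γ < 1) : ∃ C : ℝ, 0 ≤ C ∧ ∀ (n : ℕ) (h : ℝ), 0 < h →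
    ∑ k ∈ Finset.range n, min (h * ((2:ℝ) ^ k) ^ (1 - γ)) (((2:ℝ) ^ k)⁻¹ * ((2:ℝ) ^ k) ^ (1 - γ)) ≤ C * h ^ γ := by
  obtain ⟨C, hC, H⟩ := min_sum_aux h0 h1
  refine ⟨C, hC, fun n h hh => ?_⟩
  have := mul_le_mul_of_nonneg_right (H n h hh) (Real.rpow_nonneg hh.le γ)
  refine le_trans (le_of_eq ?_) this
  rw [Finset.sum_mul]
  refine Finset.sum_congr rfl fun k _ => ?_
  have hs : (0:ℝ) < 2 ^ k := by positivity
  set s : ℝ := 2 ^ k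
  rw [min_mul_of_nonneg _ _ (Real.rpow_nonneg hh.le γ), Real.mul_rpow hs.le hh.le, Real.mul_rpow hs.le hh.le]
  have a1 : h ^ (1 - γ) * h ^ γ = h := by
    rw [← Real.rpow_add hh]; simp
  have a2 : h ^ (-γ) * h ^ γ = 1 := by
    rw [← Real.rpow_add hh]; simp
  have a3 : s⁻¹ * s ^ (1 - γ) = s ^ (-γ) := by
    rw [← Real.rpow_neg_one, ← Real.rpow_add hs]; congr 1; ring
  rw [mul_assoc, mul_assoc, a1, a2, a3, mul_one, mul_comm]

lemma key1D (hρ : IsLPCutoff ρ) {γ : ℝ} (h0 : 0 < γ) (h1 : γ < 1) : ∃ C : ℝ, 0 ≤ C ∧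
    ∀ (f : ℝ → ℝ) (B A : ℝ), Continuous f → (∀ x, |f x| ≤ B) →
    (∀ k x, |LP ρ k f x| ≤ A * ((2:ℝ) ^ k) ^ (1 - γ)) → ∀ a b, |b - a| ≤ 10 →
    |∫ x in a..b, f x| ≤ C * A * |b - a| ^ γ := by
  obtain ⟨C0, hC0, H0⟩ := LP_repro_int hρ
  obtain ⟨C1, hC1, H1⟩ := min_sum h0 h1
  refine ⟨10 + 2 * (1 + C0) * C1, by positivity, fun f B A hf hB hA a b hab => ?_⟩
  have pA : 0 ≤ A := by simpa using (abs_nonneg _).trans (hA 0 0)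
  rcases eq_or_ne a b with rfl | hne
  · simp [Real.zero_rpow h0.ne']
  have ph : 0 < |b - a| := abs_pos.2 (sub_ne_zero.2 hne.symm)
  set h := |b - a| with hh
  have triv : ∀ k, |∫ x in a..b, LP ρ k f x| ≤ A * ((2:ℝ) ^ k) ^ (1 - γ) * h := by
    intro k
    rw [← Real.norm_eq_abs]
    exact intervalIntegral.norm_integral_le_of_norm_le_const fun x _ => hA k x
  have t0 : |∫ x in a..b, LP ρ 0 f x| ≤ 10 * A * h ^ γ := by
    have := triv 0
    simp only [pow_zero, Real.one_rpow, mul_one] at this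
    have e : h = h ^ (1 - γ) * h ^ γ := by rw [← Real.rpow_add ph]; simp
    have e2 : h ^ (1 - γ) ≤ 10 := by
      calc h ^ (1 - γ) ≤ 10 ^ (1 - γ) := Real.rpow_le_rpow ph.le hab (by linarith)
        _ ≤ 10 ^ (1:ℝ) := Real.rpow_le_rpow_of_exponent_le (by norm_num) (by linarith)
        _ = 10 := by norm_num
    have e3 : h ≤ 10 * h ^ γ := by
      calc h = h ^ (1 - γ) * h ^ γ := e
        _ ≤ _ := mul_le_mul_of_nonneg_right e2 (by positivity)
    nlinarith
  have tk : ∀ k, |∫ x in a..b, LP ρ (k + 1) f x| ≤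
      2 * (1 + C0) * A * min (h * ((2:ℝ) ^ k) ^ (1 - γ)) (((2:ℝ) ^ k)⁻¹ * ((2:ℝ) ^ k) ^ (1 - γ)) := by
    intro k
    have u1 := triv (k + 1)
    have u2 := H0 k f B _ hf hB (hA (k + 1)) a b
    have e2 : (2:ℝ) ^ (1 - γ) ≤ 2 := by
      calc (2:ℝ) ^ (1 - γ) ≤ 2 ^ (1:ℝ) := Real.rpow_le_rpow_of_exponent_le (by norm_num) (by linarith)
        _ = 2 := by norm_num
    have e3 : ((2:ℝ) ^ (k + 1)) ^ (1 - γ) ≤ 2 * ((2:ℝ) ^ k) ^ (1 - γ) := by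
      rw [pow_succ, Real.mul_rpow (by positivity) (by norm_num), mul_comm]
      exact mul_le_mul_of_nonneg_right e2 (by positivity)
    have hX : 0 ≤ ((2:ℝ) ^ k) ^ (1 - γ) := by positivity
    set X := ((2:ℝ) ^ k) ^ (1 - γ)
    set Y := ((2:ℝ) ^ (k + 1)) ^ (1 - γ)
    have hs : (0:ℝ) < (2 ^ k)⁻¹ := by positivity
    set s := ((2:ℝ) ^ k)⁻¹
    rcases min_choice (h * X) (s * X) with e | e
    · rw [e]
      calc _ ≤ A * Y * h := u1
        _ ≤ A * (2 * X) * h := by gcongr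
        _ = 2 * A * (h * X) := by ring
        _ ≤ 2 * (1 + C0) * A * (h * X) := by
          have : 0 ≤ 2 * C0 * A * (h * X) := by positivity
          nlinarith
    · rw [e]
      calc _ ≤ C0 * s * (A * Y) := u2
        _ ≤ C0 * s * (A * (2 * X)) := by gcongr
        _ = 2 * C0 * A * (s * X) := by ring
        _ ≤ 2 * (1 + C0) * A * (s * X) := by
          have : 0 ≤ 2 * A * (s * X) := by positivity
          nlinarith
  have hn : ∀ n : ℕ, |∑ k ∈ Finset.range (n + 1), ∫ x in a..b, LP ρ k f x| ≤
      (10 + 2 * (1 + C0) * C1) * A * h ^ γ := by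
    intro n
    rw [Finset.sum_range_succ']
    refine (abs_add_le _ _).trans ?_
    have s1 := Finset.abs_sum_le_sum_abs (fun k => ∫ x in a..b, LP ρ (k + 1) f x) (Finset.range n)
    have s2 := Finset.sum_le_sum fun k (_ : k ∈ Finset.range n) => tk k
    rw [← Finset.mul_sum] at s2
    have s3 := mul_le_mul_of_nonneg_left (H1 n h ph) (show 0 ≤ 2 * (1 + C0) * A by positivity)
    calc _ ≤ 2 * (1 + C0) * A * (C1 * h ^ γ) + 10 * A * h ^ γ := add_le_add (s1.trans (s2.trans s3)) t0
      _ = _ := by ring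
  have lim := (LP_sum_int hρ hf hB a b).abs
  have fin := le_of_tendsto' lim hn
  have hpi : 1 ≤ √(2 * π) := by
    rw [Real.one_le_sqrt]
    linarith [Real.pi_gt_three]
  rw [abs_mul, abs_of_nonneg (Real.sqrt_nonneg _)] at fin
  refine le_trans ?_ fin
  exact le_mul_of_one_le_left (abs_nonneg _) hpi

end oneD



section rect
variable {ρ : ℝ → ℝ}

lemma rect_est (hρ : IsLPCutoff ρ) {γ₁ γ₂ : ℝ} (h1 : 0 < γ₁) (h1' : γ₁ < 1) (h2 : 0 < γ₂) (h2' : γ₂ < 1) :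
    ∃ C : ℝ, 0 ≤ C ∧ ∀ (F : ℝ × ℝ → ℝ) (B A : ℝ), Continuous F → (∀ p, |F p| ≤ B) →
    (∀ k₁ k₂ p, |LPu ρ k₁ (LPv ρ k₂ F) p| ≤ A * ((2:ℝ) ^ k₁) ^ (1 - γ₁) * ((2:ℝ) ^ k₂) ^ (1 - γ₂)) →
    ∀ a b c d, |b - a| ≤ 10 → |d - c| ≤ 10 →
    |rectI F a b c d| ≤ C * A * |b - a| ^ γ₁ * |d - c| ^ γ₂ := by
  obtain ⟨C1, hC1, H1⟩ := key1D hρ h1 h1'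
  obtain ⟨C2, hC2, H2⟩ := key1D hρ h2 h2'
  refine ⟨C2 * C1, by positivity, fun F B A hF hB hA a b c d hab hcd => ?_⟩
  set f : ℝ → ℝ := fun v => ∫ u in a..b, F (u, v) with hf
  have hfc : Continuous f := cont_inner2 hF a b
  have hfb : ∀ v, |f v| ≤ B * |b - a| := by
    intro w
    rw [← Real.norm_eq_abs]
    exact intervalIntegral.norm_integral_le_of_norm_le_const fun x _ => hB _
  have hk : ∀ k v, |LP ρ k f v| ≤ C1 * A * |b - a| ^ γ₁ * ((2:ℝ) ^ k) ^ (1 - γ₂) := by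
    intro k v
    have e : LP ρ k f v = ∫ u in a..b, LPv ρ k F (u, v) :=
      (fubK (Φ := fun p : ℝ × ℝ => F (p.1, v - p.2)) (lpKernel_int hρ k) (by fun_prop) (fun _ => hB _) a b).symm
    have gc : Continuous fun u => LPv ρ k F (u, v) :=
      contK (Φ := fun p : ℝ × ℝ => F (p.1, v - p.2)) (lpKernel_int hρ k) (by fun_prop) (fun _ => hB _)
    have := H1 (fun u => LPv ρ k F (u, v)) ((∫ y, |lpKernel ρ k y|) * B) (A * ((2:ℝ) ^ k) ^ (1 - γ₂)) gc
      (fun u => abs_int_mul_le (lpKernel_int hρ k) (fun _ => hB _))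
      (fun k₁ u => by
        have := hA k₁ k (u, v)
        refine le_trans (le_of_eq ?_) (this.trans (le_of_eq ?_))
        · rfl
        · ring) a b hab
    rw [e]
    refine this.trans (le_of_eq ?_)
    ring
  have := H2 f _ (C1 * A * |b - a| ^ γ₁) hfc hfb hk c d hcd
  refine le_trans (le_of_eq rfl) (this.trans (le_of_eq ?_))
  ring

lemma rpow_le_ten {x γ : ℝ} (hx : 0 ≤ x) (hx' : x ≤ 10) (h0 : 0 ≤ γ) (h1 : γ ≤ 1) : x ^ γ ≤ 10 := by
  calc x ^ γ ≤ 10 ^ γ := Real.rpow_le_rpow hx hx' h0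
    _ ≤ 10 ^ (1:ℝ) := Real.rpow_le_rpow_of_exponent_le (by norm_num) h1
    _ = 10 := by norm_num

lemma tri_est (hρ : IsLPCutoff ρ) {γ₁ γ₂ : ℝ} (h1 : 0 < γ₁) (h1' : γ₁ < 1) (h2 : 0 < γ₂) (h2' : γ₂ < 1)
    (h12 : 1 < γ₁ + γ₂) :
    ∃ C : ℝ, 0 ≤ C ∧ ∀ (F : ℝ × ℝ → ℝ) (B A : ℝ), Continuous F → (∀ p, |F p| ≤ B) → 0 ≤ A →
    (∀ k₁ k₂ p, |LPu ρ k₁ (LPv ρ k₂ F) p| ≤ A * ((2:ℝ) ^ k₁) ^ (1 - γ₁) * ((2:ℝ) ^ k₂) ^ (1 - γ₂)) →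
    (∀ a b c d, |b - a| ≤ 10 → |d - c| ≤ 10 →
      |rectI F a b c d| ≤ C * A * |b - a| ^ γ₁ * |d - c| ^ γ₂) ∧
    (∀ a b, |b - a| ≤ 10 → |triD F a b| ≤ C * A * (|b - a| ^ γ₁ * |b - a| ^ γ₂)) := by
  obtain ⟨C, hC, H⟩ := rect_est hρ h1 h1' h2 h2'
  have hq : (2:ℝ) ^ (1 - (γ₁ + γ₂)) < 1 := Real.rpow_lt_one_of_one_lt_of_neg (by norm_num) (by linarith)
  have hS : 0 < (1 - (2:ℝ) ^ (1 - (γ₁ + γ₂)))⁻¹ := inv_pos.2 (by linarith)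
  set S := (1 - (2:ℝ) ^ (1 - (γ₁ + γ₂)))⁻¹ with hSd
  refine ⟨C + S * C, by positivity, fun F B A hF hB hA0 hA => ?_⟩
  have HR := H F B A hF hB hA
  refine ⟨fun a b c d hab hcd => (HR a b c d hab hcd).trans ?_, fun a b hab => ?_⟩
  · have : 0 ≤ S * C * A * |b - a| ^ γ₁ * |d - c| ^ γ₂ := by positivity
    nlinarith
  · have := sewing_bisect (f := triD F) (K := C * A) (M := B) h12 (by positivity) (L := 10)
      (fun a b _ => triD_bound hB a b) (fun a b hab => by
        rw [triD_cocycle hF a ((a + b) / 2) b]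
        have e1 : |(a + b) / 2 - a| = |b - a| / 2 := by
          rw [show (a + b) / 2 - a = (b - a) / 2 by ring, abs_div, abs_two]
        have e2 : |b - (a + b) / 2| = |b - a| / 2 := by
          rw [show b - (a + b) / 2 = (b - a) / 2 by ring, abs_div, abs_two]
        have hn := abs_nonneg (b - a)
        have := HR a ((a + b) / 2) ((a + b) / 2) b (by linarith) (by linarith)
        rw [e1, e2] at this
        rw [show ∀ x y z : ℝ, x + y + z - x - y = z by intros; ring]
        refine this.trans ?_
        rw [Real.rpow_add_of_nonneg hn h1.le h2.le, ← mul_assoc]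
        gcongr <;> linarith) a b hab
    rw [Real.rpow_add_of_nonneg (abs_nonneg _) h1.le h2.le, ← hSd] at this
    refine this.trans ?_
    have : 0 ≤ C * A * (|b - a| ^ γ₁ * |b - a| ^ γ₂) := by positivity
    nlinarith

/-- Product Hölder bounds on the box `[-3,3]²`. -/
structure BoxB (γ₁ γ₂ B : ℝ) (φ : ℝ → ℝ → ℝ) : Prop where
  b0 : ∀ u v, |u| ≤ 3 → |v| ≤ 3 → |φ u v| ≤ B
  bu : ∀ u u' v, |u| ≤ 3 → |u'| ≤ 3 → |v| ≤ 3 → |φ u v - φ u' v| ≤ B * |u - u'| ^ γ₁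
  bv : ∀ u v v', |u| ≤ 3 → |v| ≤ 3 → |v'| ≤ 3 → |φ u v - φ u v'| ≤ B * |v - v'| ^ γ₂
  buv : ∀ u u' v v', |u| ≤ 3 → |u'| ≤ 3 → |v| ≤ 3 → |v'| ≤ 3 →
    |(φ u v - φ u v') - (φ u' v - φ u' v')| ≤ B * |v - v'| ^ γ₂ * |u - u'| ^ γ₁

lemma box_est (hρ : IsLPCutoff ρ) {γ₁ γ₂ : ℝ} (h1 : 0 < γ₁) (h1' : γ₁ < 1) (h2 : 0 < γ₂) (h2' : γ₂ < 1)
    (h12 : 1 < γ₁ + γ₂) :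
    ∃ C : ℝ, 0 ≤ C ∧ ∀ (F : ℝ × ℝ → ℝ) (B A : ℝ), Continuous F → (∀ p, |F p| ≤ B) → 0 ≤ A →
    (∀ k₁ k₂ p, |LPu ρ k₁ (LPv ρ k₂ F) p| ≤ A * ((2:ℝ) ^ k₁) ^ (1 - γ₁) * ((2:ℝ) ^ k₂) ^ (1 - γ₂)) →
    BoxB γ₁ γ₂ (C * A) (fun u v => triD F u v) := by
  obtain ⟨C, hC, H⟩ := tri_est hρ h1 h1' h2 h2' h12
  refine ⟨100 * C, by positivity, fun F B A hF hB hA0 hA => ?_⟩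
  obtain ⟨HR, HD⟩ := H F B A hF hB hA0 hA
  have hd : ∀ x y : ℝ, |x| ≤ 3 → |y| ≤ 3 → |x - y| ≤ 10 := by
    intro x y hx hy
    have := abs_sub x y
    linarith
  have r1 : ∀ x y : ℝ, |x| ≤ 3 → |y| ≤ 3 → |x - y| ^ γ₁ ≤ 10 := fun x y hx hy =>
    rpow_le_ten (abs_nonneg _) (hd x y hx hy) h1.le h1'.le
  have r2 : ∀ x y : ℝ, |x| ≤ 3 → |y| ≤ 3 → |x - y| ^ γ₂ ≤ 10 := fun x y hx hy =>
    rpow_le_ten (abs_nonneg _) (hd x y hx hy) h2.le h2'.le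
  constructor
  · intro u v hu hv
    refine (HD u v (hd v u hv hu)).trans ?_
    calc C * A * (|v - u| ^ γ₁ * |v - u| ^ γ₂) ≤ C * A * (10 * 10) := by
          gcongr
          · exact r1 v u hv hu
          · exact r2 v u hv hu
      _ = _ := by ring
  · intro u u' v hu hu' hv
    have e := triD_cocycle hF u u' v
    rw [show triD F u v - triD F u' v = triD F u u' + rectI F u u' u' v by rw [e]; ring]
    refine (abs_add_le _ _).trans ?_
    have q1 := HD u u' (hd u' u hu' hu)
    have q2 := HR u u' u' v (hd u' u hu' hu) (hd v u' hv hu')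
    rw [abs_sub_comm u' u] at q1 q2
    have p2 := r2 u u' hu hu'
    have p3 := r2 v u' hv hu'
    have t1 : C * A * (|u - u'| ^ γ₁ * |u - u'| ^ γ₂) ≤ C * A * (|u - u'| ^ γ₁ * 10) := by gcongr
    have t2 : C * A * |u - u'| ^ γ₁ * |v - u'| ^ γ₂ ≤ C * A * |u - u'| ^ γ₁ * 10 := by gcongr
    have t3 : 0 ≤ C * A * |u - u'| ^ γ₁ := by positivity
    linarith
  · intro u v v' hu hv hv'
    have e := triD_cocycle hF u v' v
    rw [show triD F u v - triD F u v' = triD F v' v + rectI F u v' v' v by rw [e]; ring]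
    refine (abs_add_le _ _).trans ?_
    have q1 := HD v' v (hd v v' hv hv')
    have q2 := HR u v' v' v (hd v' u hv' hu) (hd v v' hv hv')
    have p2 := r1 v v' hv hv'
    have p3 := r1 v' u hv' hu
    have t1 : C * A * (|v - v'| ^ γ₁ * |v - v'| ^ γ₂) ≤ C * A * (10 * |v - v'| ^ γ₂) := by gcongr
    have t2 : C * A * |v' - u| ^ γ₁ * |v - v'| ^ γ₂ ≤ C * A * 10 * |v - v'| ^ γ₂ := by gcongr
    have t3 : 0 ≤ C * A * |v - v'| ^ γ₂ := by positivity
    linarith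
  · intro u u' v v' hu hu' hv hv'
    have e := triD_cocycle hF u u' v
    have e' := triD_cocycle hF u u' v'
    have hc := cont_inner2 hF u u'
    have e3 : rectI F u u' u' v - rectI F u u' u' v' = rectI F u u' v' v :=
      intervalIntegral.integral_interval_sub_left (hc.intervalIntegrable _ _) (hc.intervalIntegrable _ _)
    rw [show (triD F u v - triD F u v') - (triD F u' v - triD F u' v') = rectI F u u' v' v by
      rw [← e3, e, e']; ring]
    have q2 := HR u u' v' v (hd u' u hu' hu) (hd v v' hv hv')
    rw [abs_sub_comm u' u] at q2
    have t3 : 0 ≤ C * A * |u - u'| ^ γ₁ * |v - v'| ^ γ₂ := by positivity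
    nlinarith

end rect

section cut
variable {ρ χ : ℝ → ℝ}

lemma cutoff1 (hχ : IsCutoff χ) {γ : ℝ} (h0 : 0 < γ) (h1 : γ < 1) : ∃ c : ℝ, 0 ≤ c ∧ ∀ (h : ℝ → ℝ) (B : ℝ),
    (∀ x, |x| ≤ 3 → |h x| ≤ B) → (∀ x y, |x| ≤ 3 → |y| ≤ 3 → |h x - h y| ≤ B * |x - y| ^ γ) →
    HolB γ (c * B) (fun x => χ x * h x) := by
  have hcs : HasCompactSupport χ := by
    refine HasCompactSupport.intro (isCompact_Icc (a := (-(21/10) : ℝ)) (b := 21/10)) fun x hx => ?_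
    apply hχ.eq_zero
    by_contra hh
    exact hx (abs_le.1 (not_lt.1 hh))
  obtain ⟨L, hL⟩ := ContDiff.lipschitzWith_of_hasCompactSupport hcs hχ.smooth (by simp)
  have hL' : ∀ x y, |χ x - χ y| ≤ L * |x - y| := fun x y => by
    simpa [Real.dist_eq] using hL.dist_le_mul x y
  have hLp : (0:ℝ) ≤ L := L.2
  refine ⟨2 + 10 * L, by positivity, fun h B hB hh => ?_⟩
  have pB : 0 ≤ B := (abs_nonneg _).trans (hB 0 (by simp))
  have habs : ∀ x, |χ x| ≤ 1 := fun x => by rw [abs_of_nonneg (hχ.nonneg x)]; exact hχ.le_one x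
  have bd : ∀ x, |χ x * h x| ≤ B := by
    intro x
    rcases le_or_gt |x| 3 with hx | hx
    · rw [abs_mul]
      calc |χ x| * |h x| ≤ 1 * B := mul_le_mul (habs x) (hB x hx) (abs_nonneg _) zero_le_one
        _ = B := one_mul B
    · rw [hχ.eq_zero x (by linarith)]
      simpa using pB
  have out : ∀ x y : ℝ, 3 < |x| → |χ x * h x - χ y * h y| ≤ 2 * B * |x - y| ^ γ := by
    intro x y hx
    rw [hχ.eq_zero x (by linarith), zero_mul, zero_sub, abs_neg]
    rcases le_or_gt |y| (21 / 10) with hy | hy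
    · have hd : 9 / 10 ≤ |x - y| := by
        have := abs_sub_abs_le_abs_sub x y
        linarith
      have : (1:ℝ) / 2 ≤ |x - y| ^ γ := by
        rcases le_or_gt |x - y| 1 with h' | h'
        · calc (1:ℝ) / 2 ≤ |x - y| := by linarith
            _ = |x - y| ^ (1:ℝ) := (Real.rpow_one _).symm
            _ ≤ _ := Real.rpow_le_rpow_of_exponent_ge (by linarith) h' h1.le
        · have := Real.one_le_rpow h'.le h0.le
          linarith
      have := bd y
      nlinarith
    · rw [hχ.eq_zero y hy]
      simp only [zero_mul, abs_zero]
      positivity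
  refine ⟨fun x => (bd x).trans ?_, fun x y => ?_⟩
  · nlinarith [mul_nonneg hLp pB]
  · have hr : 0 ≤ |x - y| ^ γ := by positivity
    have hLB : 0 ≤ L * B * |x - y| ^ γ := by positivity
    have hBB : 0 ≤ B * |x - y| ^ γ := by positivity
    rcases le_or_gt |x| 3 with hx | hx
    · rcases le_or_gt |y| 3 with hy | hy
      · have e : χ x * h x - χ y * h y = χ x * (h x - h y) + (χ x - χ y) * h y := by ring
        simp only
        rw [e]
        refine (abs_add_le _ _).trans ?_
        rw [abs_mul, abs_mul]
        have hd : |x - y| ≤ 10 := by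
          have := abs_sub x y
          linarith
        have hxy : |x - y| ≤ 10 * |x - y| ^ γ := by
          calc |x - y| = |x - y| ^ (1 - γ) * |x - y| ^ γ := by
                rw [← Real.rpow_add_of_nonneg (abs_nonneg _) (by linarith) h0.le]; simp
            _ ≤ _ := mul_le_mul_of_nonneg_right (rpow_le_ten (abs_nonneg _) hd (by linarith) (by linarith)) hr
        have t1 : |χ x| * |h x - h y| ≤ 1 * (B * |x - y| ^ γ) :=
          mul_le_mul (habs x) (hh x y hx hy) (abs_nonneg _) zero_le_one
        have t2 : |χ x - χ y| * |h y| ≤ (L * (10 * |x - y| ^ γ)) * B :=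
          mul_le_mul ((hL' x y).trans (mul_le_mul_of_nonneg_left hxy hLp)) (hB y hy) (abs_nonneg _) (by positivity)
        linarith
      · have := out y x hy
        rw [abs_sub_comm, abs_sub_comm y x] at this
        simp only
        linarith
    · have := out x y hx
      simp only
      linarith

lemma LP_sub (hρ : IsLPCutoff ρ) (k : ℕ) {f g : ℝ → ℝ} {B B' : ℝ} (hf : Continuous f) (hfB : ∀ x, |f x| ≤ B)
    (hg : Continuous g) (hgB : ∀ x, |g x| ≤ B') (x : ℝ) :
    LP ρ k f x - LP ρ k g x = LP ρ k (fun y => f y - g y) x := by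
  unfold LP
  rw [← integral_sub (int_mul_bdd (lpKernel_int hρ k) (f := fun y => f (x - y)) (by fun_prop) (fun _ => hfB _))
    (int_mul_bdd (lpKernel_int hρ k) (f := fun y => g (x - y)) (by fun_prop) (fun _ => hgB _))]
  congr 1
  funext y
  ring

lemma cut_est (hρ : IsLPCutoff ρ) (hχ : IsCutoff χ) {γ₁ γ₂ : ℝ} (h1 : 0 < γ₁) (h1' : γ₁ < 1) (h2 : 0 < γ₂) (h2' : γ₂ < 1) :
    ∃ C : ℝ, 0 ≤ C ∧ ∀ (φ : ℝ → ℝ → ℝ) (B : ℝ), BoxB γ₁ γ₂ B φ →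
    ∀ k₁ k₂ p, |LPu ρ k₁ (LPv ρ k₂ (fun p => χ p.1 * χ p.2 * φ p.1 p.2)) p| ≤
      C * B * ((2:ℝ) ^ k₁) ^ (-γ₁) * ((2:ℝ) ^ k₂) ^ (-γ₂) := by
  obtain ⟨c1, hc1, H1⟩ := cutoff1 hχ h1 h1'
  obtain ⟨c2, hc2, H2⟩ := cutoff1 hχ h2 h2'
  obtain ⟨L1, hL1, K1⟩ := LP_holder hρ h1 h1'.le
  obtain ⟨L2, hL2, K2⟩ := LP_holder hρ h2 h2'.le
  refine ⟨L1 * L2 * c2 * c1, by positivity, fun φ B HB k₁ k₂ p => ?_⟩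
  have pB : 0 ≤ B := (abs_nonneg _).trans (HB.b0 0 0 (by simp) (by simp))
  have A1 : ∀ v, |v| ≤ 3 → HolB γ₁ (c1 * B) (fun u => χ u * φ u v) := fun v hv =>
    H1 (fun u => φ u v) B (fun u hu => HB.b0 u v hu hv) (fun u u' hu hu' => HB.bu u u' v hu hu' hv)
  have A2 : ∀ v v', |v| ≤ 3 → |v'| ≤ 3 → HolB γ₁ (c1 * (B * |v - v'| ^ γ₂)) (fun u => χ u * (φ u v - φ u v')) :=
    fun v v' hv hv' => H1 (fun u => φ u v - φ u v') (B * |v - v'| ^ γ₂) (fun u hu => HB.bv u v v' hu hv hv')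
      (fun u u' hu hu' => HB.buv u u' v v' hu hu' hv hv')
  have B1 : ∀ u, HolB γ₂ (c2 * (c1 * B)) (fun v => χ v * (χ u * φ u v)) := fun u =>
    H2 (fun v => χ u * φ u v) (c1 * B) (fun v hv => (A1 v hv).1 u) (fun v v' hv hv' => by
      have := (A2 v v' hv hv').1 u
      simp only at this ⊢
      rw [← mul_sub]
      linarith)
  have B2 : ∀ u u', HolB γ₂ (c2 * (c1 * B * |u - u'| ^ γ₁)) (fun v => χ v * (χ u * φ u v - χ u' * φ u' v)) := fun u u' =>
    H2 (fun v => χ u * φ u v - χ u' * φ u' v) (c1 * B * |u - u'| ^ γ₁) (fun v hv => (A1 v hv).2 u u')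
      (fun v v' hv hv' => by
        have := (A2 v v' hv hv').2 u u'
        simp only at this ⊢
        rw [show χ u * φ u v - χ u' * φ u' v - (χ u * φ u v' - χ u' * φ u' v') =
          χ u * (φ u v - φ u v') - χ u' * (φ u' v - φ u' v') by ring]
        linarith)
  obtain ⟨u, v⟩ := p
  have hH : HolB γ₁ (L2 * (c2 * (c1 * B)) * ((2:ℝ) ^ k₂) ^ (-γ₂)) (fun u => LP ρ k₂ (fun v => χ v * (χ u * φ u v)) v) := by
    refine ⟨fun u => K2 _ _ (B1 u) k₂ v, fun u u' => ?_⟩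
    simp only
    rw [LP_sub hρ k₂ ((B1 u).continuous h2) (B1 u).1 ((B1 u').continuous h2) (B1 u').1]
    have := K2 _ _ (B2 u u') k₂ v
    simp_rw [mul_sub] at this
    linarith
  have := K1 _ _ hH k₁ u
  have e : LPu ρ k₁ (LPv ρ k₂ (fun p => χ p.1 * χ p.2 * φ p.1 p.2)) (u, v) =
      LP ρ k₁ (fun u => LP ρ k₂ (fun v => χ v * (χ u * φ u v)) v) u := by
    unfold LPu LPv LP
    simp only
    congr 1
    funext y
    congr 2
    funext z
    ring
  rw [e]
  refine this.trans (le_of_eq ?_)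
  ring

lemma part4 (hρ : IsLPCutoff ρ) (hχ : IsCutoff χ) {γ₁ γ₂ : ℝ} (h1 : 0 < γ₁) (h1' : γ₁ < 1) (h2 : 0 < γ₂) (h2' : γ₂ < 1)
    (h12 : 1 < γ₁ + γ₂) :
    ∃ C : ℝ≥0∞, C ≠ ∞ ∧ ∀ F : ℝ × ℝ → ℝ, CbSmooth F →
        hNorm2 ρ γ₁ γ₂ (fun p => χ p.1 * χ p.2 * Duh F p) ≤
          C * hNorm2 ρ (γ₁ - 1) (γ₂ - 1) F := by
  obtain ⟨C1, hC1, H1⟩ := box_est hρ h1 h1' h2 h2' h12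
  obtain ⟨C2, hC2, H2⟩ := cut_est hρ hχ h1 h1' h2 h2'
  refine ⟨ENNReal.ofReal (C2 * C1 + 1), ENNReal.ofReal_ne_top, fun F hF => ?_⟩
  obtain ⟨B, hB⟩ := hF.bounded
  have hFc : Continuous F := hF.1.continuous
  rcases eq_or_ne (hNorm2 ρ (γ₁ - 1) (γ₂ - 1) F) ∞ with htop | hfin
  · rw [htop, ENNReal.mul_top]
    · exact le_top
    · simp only [ne_eq, ENNReal.ofReal_eq_zero, not_le]
      positivity
  set A := (hNorm2 ρ (γ₁ - 1) (γ₂ - 1) F).toReal with hAd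
  have hA0 : 0 ≤ A := ENNReal.toReal_nonneg
  have hAe : hNorm2 ρ (γ₁ - 1) (γ₂ - 1) F = ENNReal.ofReal A := (ENNReal.ofReal_toReal hfin).symm
  have hA : ∀ k₁ k₂ p, |LPu ρ k₁ (LPv ρ k₂ F) p| ≤ A * ((2:ℝ) ^ k₁) ^ (1 - γ₁) * ((2:ℝ) ^ k₂) ^ (1 - γ₂) := by
    intro k₁ k₂ p
    have i1 : ENNReal.ofReal (((2 : ℝ) ^ k₁) ^ (γ₁ - 1) * ((2 : ℝ) ^ k₂) ^ (γ₂ - 1)) *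
        ENNReal.ofReal |LPu ρ k₁ (LPv ρ k₂ F) p| ≤ ENNReal.ofReal A := by
      rw [← hAe]
      refine le_trans ?_ (le_iSup_of_le k₁ (le_iSup_of_le k₂ le_rfl))
      gcongr
      exact le_iSup (fun p : ℝ × ℝ => ENNReal.ofReal |LPu ρ k₁ (LPv ρ k₂ F) p|) p
    rw [← ENNReal.ofReal_mul (by positivity), ENNReal.ofReal_le_ofReal_iff hA0] at i1
    have q : ∀ (k : ℕ) (γ : ℝ), ((2:ℝ) ^ k) ^ (γ - 1) * ((2:ℝ) ^ k) ^ (1 - γ) = 1 := by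
      intro k γ
      rw [← Real.rpow_add (by positivity)]
      simp
    have i2 := mul_le_mul_of_nonneg_right i1 (show 0 ≤ ((2:ℝ) ^ k₁) ^ (1 - γ₁) * ((2:ℝ) ^ k₂) ^ (1 - γ₂) by positivity)
    calc |LPu ρ k₁ (LPv ρ k₂ F) p| = (((2:ℝ) ^ k₁) ^ (γ₁ - 1) * ((2:ℝ) ^ k₁) ^ (1 - γ₁)) *
          (((2:ℝ) ^ k₂) ^ (γ₂ - 1) * ((2:ℝ) ^ k₂) ^ (1 - γ₂)) * |LPu ρ k₁ (LPv ρ k₂ F) p| := by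
            rw [q, q]; ring
      _ ≤ _ := by linarith
  have HBx := H1 F B A hFc hB hA0 hA
  have HBx' : BoxB γ₁ γ₂ (C1 * A) (fun u v => Duh F (u, v)) := by
    constructor
    · intro u v hu hv
      simpa only [duh_eq, abs_neg] using HBx.b0 u v hu hv
    · intro u u' v hu hu' hv
      simp only [duh_eq]
      rw [← abs_neg]
      convert HBx.bu u u' v hu hu' hv using 2
      ring
    · intro u v v' hu hv hv'
      simp only [duh_eq]
      rw [← abs_neg]
      convert HBx.bv u v v' hu hv hv' using 2
      ring
    · intro u u' v v' hu hu' hv hv'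
      simp only [duh_eq]
      rw [← abs_neg]
      convert HBx.buv u u' v v' hu hu' hv hv' using 2
      ring
  have fin := H2 _ _ HBx'
  rw [hAe, ← ENNReal.ofReal_mul (by positivity)]
  unfold hNorm2
  refine iSup_le fun k₁ => iSup_le fun k₂ => ?_
  rw [ENNReal.mul_iSup]
  refine iSup_le fun p => ?_
  rw [← ENNReal.ofReal_mul (by positivity)]
  apply ENNReal.ofReal_le_ofReal
  have f1 := mul_le_mul_of_nonneg_left (fin k₁ k₂ p) (show 0 ≤ ((2:ℝ) ^ k₁) ^ γ₁ * ((2:ℝ) ^ k₂) ^ γ₂ by positivity)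
  refine f1.trans ?_
  have q : ∀ (k : ℕ) (γ : ℝ), ((2:ℝ) ^ k) ^ γ * ((2:ℝ) ^ k) ^ (-γ) = 1 := by
    intro k γ
    rw [← Real.rpow_add (by positivity)]
    simp
  calc _ = (((2:ℝ) ^ k₁) ^ γ₁ * ((2:ℝ) ^ k₁) ^ (-γ₁)) * (((2:ℝ) ^ k₂) ^ γ₂ * ((2:ℝ) ^ k₂) ^ (-γ₂)) * (C2 * (C1 * A)) := by
        ring
    _ = C2 * C1 * A := by rw [q, q]; ring
    _ ≤ _ := by linarith

end cut

/-- **Proposition 2.20: the Duhamel integral in null coordinates.**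
For `C_b^∞` forcing `F` and `φ = Duh[F]`: (1) the order of integration can be exchanged;
(2) `φ` is smooth and `∂_u ∂_v φ = F`; (3) `φ` and `(∂_v − ∂_u)φ` vanish on the diagonal;
(4) `‖χ⁺χ⁻φ‖_{C_u^{γ₁}C_v^{γ₂}} ≲ ‖F‖_{C_u^{γ₁−1}C_v^{γ₂−1}}` whenever `γ₁, γ₂ ∈ (0,1)` and
`γ₁ + γ₂ > 1`. -/
theorem duhamel_integral
    (ρ : ℝ → ℝ) (hρ : IsLPCutoff ρ)
    (χ : ℝ → ℝ) (hχ : IsCutoff χ) :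
    (∀ F : ℝ × ℝ → ℝ, CbSmooth F →
      (∀ u v : ℝ, Duh F (u, v) = -∫ u' in u..v, ∫ v' in u'..v, F (u', v')) ∧
      (ContDiff ℝ (⊤ : ℕ∞) (fun p : ℝ × ℝ => Duh F p) ∧
        ∀ u v : ℝ, deriv (fun u' => deriv (fun v' => Duh F (u', v')) v) u = F (u, v)) ∧
      (∀ x : ℝ, Duh F (x, x) = 0 ∧
        deriv (fun v => Duh F (x, v)) x - deriv (fun u => Duh F (u, x)) x = 0)) ∧
    (∀ γ₁ γ₂ : ℝ, 0 < γ₁ → γ₁ < 1 → 0 < γ₂ → γ₂ < 1 → 1 < γ₁ + γ₂ →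
      ∃ C : ℝ≥0∞, C ≠ ∞ ∧ ∀ F : ℝ × ℝ → ℝ, CbSmooth F →
        hNorm2 ρ γ₁ γ₂ (fun p => χ p.1 * χ p.2 * Duh F p) ≤
          C * hNorm2 ρ (γ₁ - 1) (γ₂ - 1) F) := by
  exact ⟨duhamel_part1, fun _ _ h1 h1' h2 h2' h12 => part4 hρ hχ h1 h1' h2 h2' h12⟩
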